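/- arXiv:2507.06032 — 2 statements merged into one kernel-verified Lean document; each statement's English description precedes it below -/
import Mathlib

section
/- There is a constant C > 0 such that for every online metric facility location instance and every prediction X̂ : Finset V, there exists a deterministic online algorithm ALG such that for every nonempty duplicate-free client sequence σ, cost(ALG, σ) ≤ C · ( 1 + log(2 + η(σ)) / (1 + log(1 + log(2 + η(σ)))) ) · opt(σ.toFinset), where log is the natural logarithm. -/
open Finset

variable {V : Type} [Fintype V] [DecidableEq V] [MetricSpace V]

/-- Connection cost of client `a` to the closest open facility in `T`. -/
noncomputable def connCost (T : Finset V) (a : V) : ℝ :=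
  sInf ↑(T.image fun v => dist a v)

/-- Facility-location cost of opening `T` and connecting the clients of `A`. -/
noncomputable def flCost (f : V → ℝ) (T A : Finset V) : ℝ :=
  ∑ v ∈ T, f v + ∑ a ∈ A, connCost T a

/-- Offline optimum: cheapest nonempty facility set serving all clients of `A`. -/
noncomputable def flOpt (f : V → ℝ) (A : Finset V) : ℝ :=
  sInf {r : ℝ | ∃ T : Finset V, T.Nonempty ∧ r = flCost f T A}

/-- A deterministic online algorithm for facility location: prefix-monotone,
nonempty on nonempty input. -/
def FLOnlineAlg (ALG : List V → Finset V) : Prop :=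
  (∀ (σ : List V) (x : V), ALG σ ⊆ ALG (σ ++ [x])) ∧
  ∀ σ : List V, σ ≠ [] → (ALG σ).Nonempty

/-- Total online cost: final facility opening costs plus each client's connection
cost at the moment of its arrival. -/
noncomputable def flAlgCost (f : V → ℝ) (ALG : List V → Finset V) (σ : List V) : ℝ :=
  ∑ v ∈ ALG σ, f v +
    ∑ i : Fin σ.length, connCost (ALG (σ.take (i + 1))) (σ.get i)

/-- The prediction error η(σ) = min(|Xσ|, |Xσ \ X̂| + |X̂ \ Xσ|). -/
def predErr (Xhat : Finset V) (σ : List V) : ℕ :=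
  min σ.toFinset.card ((σ.toFinset \ Xhat).card + (Xhat \ σ.toFinset).card)

set_option linter.unusedSectionVars false
set_option linter.unusedSimpArgs false

namespace FLProof

lemma connCost_le {T : Finset V} {v : V} (a : V) (hv : v ∈ T) : connCost T a ≤ dist a v := by
  unfold connCost
  refine csInf_le (Finset.bddBelow _) ?_
  simp only [Finset.coe_image]
  exact ⟨v, hv, rfl⟩

lemma connCost_exists {T : Finset V} (a : V) (hT : T.Nonempty) :
    ∃ v ∈ T, connCost T a = dist a v := by
  have h : (T.image fun v => dist a v).Nonempty := hT.image _
  have := Finset.Nonempty.csInf_mem h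
  simp only [Finset.mem_image] at this
  obtain ⟨v, hv, e⟩ := this
  exact ⟨v, hv, e.symm⟩

lemma connCost_nonneg (T : Finset V) (a : V) : 0 ≤ connCost T a := by
  rcases T.eq_empty_or_nonempty with rfl | h
  · simp [connCost]
  · obtain ⟨v, _, e⟩ := connCost_exists a h
    rw [e]; exact dist_nonneg

lemma connCost_anti {S T : Finset V} (a : V) (hS : S.Nonempty) (h : S ⊆ T) :
    connCost T a ≤ connCost S a := by
  obtain ⟨v, hv, e⟩ := connCost_exists a hS
  rw [e]; exact connCost_le a (h hv)

lemma connCost_tri {T : Finset V} (a b : V) (hT : T.Nonempty) :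
    connCost T a ≤ connCost T b + dist a b := by
  obtain ⟨v, hv, e⟩ := connCost_exists b hT
  rw [e]
  have := connCost_le a hv
  have := dist_triangle a b v
  linarith

lemma flCost_nonneg {f : V → ℝ} (hf : ∀ v, 0 ≤ f v) (T A : Finset V) : 0 ≤ flCost f T A :=
  add_nonneg (Finset.sum_nonneg fun v _ => hf v)
    (Finset.sum_nonneg fun v _ => connCost_nonneg T v)

lemma flOpt_exists [Nonempty V] (f : V → ℝ) (A : Finset V) :
    ∃ T : Finset V, T.Nonempty ∧ flOpt f A = flCost f T A := by
  have hfin : {r : ℝ | ∃ T : Finset V, T.Nonempty ∧ r = flCost f T A}.Finite := by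
    refine (Set.finite_range (fun T : Finset V => flCost f T A)).subset ?_
    rintro r ⟨T, _, rfl⟩
    exact ⟨T, rfl⟩
  have hne : {r : ℝ | ∃ T : Finset V, T.Nonempty ∧ r = flCost f T A}.Nonempty := by
    obtain ⟨v⟩ := ‹Nonempty V›
    exact ⟨_, {v}, Finset.singleton_nonempty v, rfl⟩
  exact hne.csInf_mem hfin

lemma flOpt_le {f : V → ℝ} (hf : ∀ v, 0 ≤ f v) {T : Finset V} (A : Finset V) (hT : T.Nonempty) :
    flOpt f A ≤ flCost f T A := by
  refine csInf_le ⟨0, ?_⟩ ⟨T, hT, rfl⟩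
  rintro r ⟨S, _, rfl⟩
  exact flCost_nonneg hf S A

lemma flOpt_nonneg {f : V → ℝ} (hf : ∀ v, 0 ≤ f v) (A : Finset V) : 0 ≤ flOpt f A := by
  refine Real.sInf_nonneg ?_
  rintro r ⟨S, _, rfl⟩
  exact flCost_nonneg hf S A

lemma flCost_mono (f : V → ℝ) (T : Finset V) {A B : Finset V} (h : A ⊆ B) :
    flCost f T A ≤ flCost f T B := by
  unfold flCost
  gcongr
  exact fun i _ _ => connCost_nonneg T i

lemma flOpt_mono {f : V → ℝ} (hf : ∀ v, 0 ≤ f v) {A B : Finset V} (h : A ⊆ B) :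
    flOpt f A ≤ flOpt f B := by
  by_cases hV : Nonempty V
  · obtain ⟨T, hT, e⟩ := flOpt_exists f B
    rw [e]
    exact (flOpt_le hf A hT).trans (flCost_mono f T h)
  · have : IsEmpty V := not_nonempty_iff.mp hV
    have : A = B := Subsingleton.elim _ _
    rw [this]

/-- cost of a history-indexed algorithm (most recent client first) -/
noncomputable def hcost (f : V → ℝ) (G : List V → Finset V) : List V → ℝ
  | [] => ∑ v ∈ G [], f v
  | x :: h => hcost f G h + ∑ v ∈ G (x :: h) \ G h, f v + connCost (G (x :: h)) x

lemma flAlgCost_eq (f : V → ℝ) (G : List V → Finset V) (hG : ∀ x h, G h ⊆ G (x :: h))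
    (h : List V) :
    flAlgCost f (fun σ => G σ.reverse) h.reverse = hcost f G h := by
  induction h with
  | nil =>
    have e : ∀ g : Fin ([] : List V).reverse.length → ℝ, ∑ i, g i = 0 :=
      fun g => Finset.sum_eq_zero (fun i _ => absurd i.2 (by simp))
    unfold flAlgCost hcost
    rw [e]
    simp
  | cons x h ih =>
    rw [hcost, ← ih]
    unfold flAlgCost
    have e : ∀ σ : List V, ∑ i : Fin σ.length, connCost (G (σ.take (i + 1)).reverse) (σ.get i)
        = ∑ i ∈ Finset.range σ.length, connCost (G (σ.take (i + 1)).reverse) (σ.getD i x) := by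
      intro σ
      rw [Finset.sum_range]
      refine Finset.sum_congr rfl fun i _ => ?_
      simp
    simp only [e]
    simp only [List.reverse_cons, List.length_append, List.length_cons, List.length_nil,
      List.length_reverse, zero_add, Finset.sum_range_succ, List.reverse_append, List.reverse_nil,
      List.nil_append, List.reverse_reverse, List.cons_append]
    have e1 : (List.take (h.length + 1) (h.reverse ++ [x])) = h.reverse ++ [x] := by
      apply List.take_of_length_le; simp
    have e2 : (h.reverse ++ [x]).getD h.length x = x := by
      simp [List.getD_append_right]
    rw [e1, e2]
    have e3 : ∀ i ∈ Finset.range h.length,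
        connCost (G (List.take (i + 1) (h.reverse ++ [x])).reverse) ((h.reverse ++ [x]).getD i x)
        = connCost (G (List.take (i + 1) (h.reverse)).reverse) ((h.reverse).getD i x) := by
      intro i hi
      rw [Finset.mem_range] at hi
      rw [List.take_append_of_le_length (by simp; omega), List.getD_append _ _ _ _ (by simpa)]
    rw [Finset.sum_congr rfl e3, ← Finset.sum_sdiff (hG x h)]
    simp
    ring

lemma exists_lev (n : ℕ) : ∃ k : ℕ, n ≤ (2 ^ (k + 1)) ^ (2 ^ (k + 1)) := by
  refine ⟨n, ?_⟩
  have h1 : n ≤ 2 ^ (n + 1) := (Nat.lt_two_pow_self).le.trans (Nat.pow_le_pow_right (by norm_num) (by omega))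
  refine h1.trans (Nat.le_self_pow (by positivity) _)

noncomputable def lev (n : ℕ) : ℕ := Nat.find (exists_lev n)

lemma lev_spec (n : ℕ) : n ≤ (2 ^ (lev n + 1)) ^ (2 ^ (lev n + 1)) := Nat.find_spec (exists_lev n)

lemma lev_mono {m n : ℕ} (h : m ≤ n) : lev m ≤ lev n :=
  Nat.find_min' _ (h.trans (lev_spec n))

/-- state of the base algorithm -/
structure OSt (V : Type) where
  F : Finset V
  cr : V → ℝ
  rad : V → ℝ

noncomputable def pot (s : OSt V) (w : V) : ℝ :=
  ∑ v, if dist v w ≤ s.rad v then s.cr v else 0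

open Classical in
noncomputable def trig (f : V → ℝ) (s : OSt V) (u : V) (x : ℝ) : Finset V :=
  Finset.univ.filter (fun w => dist u w ≤ connCost s.F u / x ∧ f w ≤ connCost s.F u + pot s w)

lemma exists_best (f : V → ℝ) (W : Finset V) (u : V) :
    ∃ w : V, W.Nonempty → w ∈ W ∧ ∀ w' ∈ W, f w + dist u w ≤ f w' + dist u w' := by
  by_cases h : W.Nonempty
  · obtain ⟨w, hw, hm⟩ := Finset.exists_min_image W (fun w => f w + dist u w) h
    exact ⟨w, fun _ => ⟨hw, hm⟩⟩
  · exact ⟨u, fun h' => absurd h' h⟩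

noncomputable def best (f : V → ℝ) (W : Finset V) (u : V) : V := (exists_best f W u).choose

lemma best_spec (f : V → ℝ) (W : Finset V) (u : V) (h : W.Nonempty) :
    best f W u ∈ W ∧ ∀ w' ∈ W, f (best f W u) + dist u (best f W u) ≤ f w' + dist u w' :=
  (exists_best f W u).choose_spec h

open Classical in
noncomputable def step (f : V → ℝ) (s : OSt V) (u : V) (x : ℝ) : OSt V :=
  if s.F = ∅ then { s with F := {best f Finset.univ u} }
  else if (trig f s u x).Nonempty then
    { F := insert (best f (trig f s u x) u) s.F
      cr := fun v => if dist v (best f (trig f s u x) u) ≤ s.rad v then 0 else s.cr v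
      rad := s.rad }
  else
    { F := s.F
      cr := Function.update s.cr u (connCost s.F u)
      rad := Function.update s.rad u (connCost s.F u / x) }

open Classical in
noncomputable def charge (f : V → ℝ) (s : OSt V) (u : V) (x : ℝ) : ℝ :=
  if (trig f s u x).Nonempty then
    min (2 * connCost s.F u) (f (best f (trig f s u x) u) + dist u (best f (trig f s u x) u))
  else 2 * connCost s.F u

lemma charge_le (f : V → ℝ) (s : OSt V) (u : V) (x : ℝ) : charge f s u x ≤ 2 * connCost s.F u := by
  unfold charge
  split_ifs
  · exact min_le_left _ _
  · exact le_rfl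

/-- The invariant of a cluster. -/
def Main (f : V → ℝ) (c : V) (K : ℕ) (M : ℝ) (s : OSt V) (h : List V) (G : ℝ) : Prop :=
  ∃ (e : ℕ) (Ds : ℝ) (E : Finset V), e ≤ K ∧ connCost s.F c ≤ Ds ∧ Ds * (K : ℝ) ^ e ≤ M ∧
    (∀ v ∈ E, v ∈ h ∧ dist v c ≤ s.rad v ∧ s.rad v ≤ Ds / (2 * K)) ∧
    (E.Nonempty → M < (K : ℝ) ^ K * Ds) ∧ ∑ v ∈ E, s.cr v ≤ f c ∧
    G ≤ 2 * f c + 4 * f c * e + 2 * ∑ v ∈ E, s.cr v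

lemma bump {K e : ℕ} {M Ds : ℝ} (hK : 1 ≤ K) (h1 : Ds * (K : ℝ) ^ e ≤ M)
    (h2 : M < (K : ℝ) ^ K * Ds) (h3 : 0 ≤ Ds) : e + 1 ≤ K ∧ Ds / K * (K : ℝ) ^ (e + 1) ≤ M := by
  have hK' : (1 : ℝ) ≤ K := by exact_mod_cast hK
  constructor
  · by_contra hcon
    have : K ≤ e := by omega
    have := pow_le_pow_right₀ hK' this
    nlinarith
  · have : Ds / K * (K : ℝ) ^ (e + 1) = Ds * (K : ℝ) ^ e := by
      field_simp
      ring
    rw [this]; exact h1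

lemma main_step_other {f : V → ℝ} {c : V} {K : ℕ} {M : ℝ} {s : OSt V}
    {h : List V} {G : ℝ} {u : V} {x : ℝ} (hf : ∀ v, 0 ≤ f v) (hK : 1 ≤ K)
    (hm : Main f c K M s h G) (hF : s.F.Nonempty) (hu : u ∉ h) :
    Main f c K M (step f s u x) (u :: h) G := by
  obtain ⟨e, Ds, E, heK, hD, hDM, hE, hEn, hEs, hG⟩ := hm
  have hK' : (1 : ℝ) ≤ K := by exact_mod_cast hK
  have hD0 : 0 ≤ Ds := (connCost_nonneg _ _).trans hD
  unfold step
  rw [if_neg hF.ne_empty]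
  split_ifs with ht
  · set w := best f (trig f s u x) u with hw
    by_cases hr : ∃ v ∈ E, dist v w ≤ s.rad v
    · obtain ⟨v, hv, hvw⟩ := hr
      obtain ⟨hb1, hb2⟩ := bump hK hDM (hEn ⟨v, hv⟩) hD0
      refine ⟨e + 1, Ds / K, ∅, hb1, ?_, hb2, by simp, by simp, by simpa using hf c, ?_⟩
      · obtain ⟨_, h2, h3⟩ := hE v hv
        have h4 := connCost_le c (Finset.mem_insert_self w s.F)
        have h5 := dist_triangle_left c w v
        have : Ds / K = Ds / (2 * K) + Ds / (2 * K) := by field_simp; ring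
        simp only
        linarith
      · push_cast
        simp only [Finset.sum_empty]
        linarith [hf c]
    · push Not at hr
      have hs : ∑ v ∈ E, (if dist v w ≤ s.rad v then 0 else s.cr v) = ∑ v ∈ E, s.cr v :=
        Finset.sum_congr rfl fun v hv => if_neg (not_le.mpr (hr v hv))
      refine ⟨e, Ds, E, heK, ?_, hDM, ?_, hEn, ?_, ?_⟩
      · exact (connCost_anti c hF (Finset.subset_insert _ _)).trans hD
      · intro v hv
        exact ⟨List.mem_cons_of_mem _ (hE v hv).1, (hE v hv).2⟩
      · simp only [hs]; exact hEs
      · simp only [hs]; exact hG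
  · have hne : ∀ v ∈ E, v ≠ u := fun v hv hvu => hu (hvu ▸ (hE v hv).1)
    have hs : ∑ v ∈ E, (Function.update s.cr u (connCost s.F u)) v = ∑ v ∈ E, s.cr v :=
        Finset.sum_congr rfl fun v hv => Function.update_of_ne (hne v hv) _ _
    refine ⟨e, Ds, E, heK, hD, hDM, ?_, hEn, ?_, ?_⟩
    · intro v hv
      simp only
      rw [Function.update_of_ne (hne v hv)]
      exact ⟨List.mem_cons_of_mem _ (hE v hv).1, (hE v hv).2⟩
    · simp only [hs]; exact hEs
    · simp only [hs]; exact hG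

lemma pot_ge {s : OSt V} {c : V} (hcr : ∀ v, 0 ≤ s.cr v) (E : Finset V)
    (hE : ∀ v ∈ E, dist v c ≤ s.rad v) : ∑ v ∈ E, s.cr v ≤ pot s c := by
  unfold pot
  calc ∑ v ∈ E, s.cr v = ∑ v ∈ E, (if dist v c ≤ s.rad v then s.cr v else 0) :=
        Finset.sum_congr rfl fun v hv => (if_pos (hE v hv)).symm
    _ ≤ _ := Finset.sum_le_sum_of_subset_of_nonneg (Finset.subset_univ _) (by
        intro i _ _
        split_ifs
        · exact hcr i
        · exact le_rfl)

lemma main_step_good {f : V → ℝ} {c : V} {K : ℕ} {M : ℝ} {s : OSt V}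
    {h : List V} {G : ℝ} {u : V} {x : ℝ} (hf : ∀ v, 0 ≤ f v) (hK : 1 ≤ K) (hx : x = 4 * K)
    (hm : Main f c K M s h G) (hF : s.F.Nonempty) (hu : u ∉ h) (hcr : ∀ v, 0 ≤ s.cr v)
    (hgood : dist u c ≤ connCost s.F u / x) (hbig : 2 * M < (K : ℝ) ^ K * connCost s.F u) :
    ∃ δ, charge f s u x ≤ δ + dist u c ∧ Main f c K M (step f s u x) (u :: h) (G + δ) := by
  obtain ⟨e, Ds, E, heK, hD, hDM, hE, hEn, hEs, hG⟩ := hm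
  have hK' : (1 : ℝ) ≤ K := by exact_mod_cast hK
  have hD0 : 0 ≤ Ds := (connCost_nonneg _ _).trans hD
  set a := connCost s.F u with ha
  have ha0 : 0 ≤ a := connCost_nonneg _ _
  have hax : a / x ≤ a / 4 := by
    rw [hx]; apply div_le_div_of_nonneg_left ha0 (by norm_num); linarith
  have haD : a ≤ 2 * Ds := by
    have := connCost_tri u c hF
    linarith
  have hrad : a / x ≤ Ds / (2 * K) := by
    rw [hx, div_le_div_iff₀ (by positivity) (by positivity)]
    nlinarith
  have hMD : M < (K : ℝ) ^ K * Ds := by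
    have : (0:ℝ) ≤ (K : ℝ) ^ K := by positivity
    nlinarith
  obtain ⟨hb1, hb2⟩ := bump hK hDM hMD hD0
  have hpot := pot_ge hcr E (fun v hv => (hE v hv).2.1)
  have hcW : c ∉ trig f s u x → ∑ v ∈ E, s.cr v + a < f c := by
    intro hc
    simp only [trig, Finset.mem_filter, Finset.mem_univ, true_and, not_and, not_le] at hc
    have := hc hgood
    linarith
  have hKK : Ds / K = Ds / (2 * K) + Ds / (2 * K) := by field_simp; ring
  by_cases ht : (trig f s u x).Nonempty
  · obtain ⟨hw1, hw2⟩ := best_spec f _ u ht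
    have hch : charge f s u x = min (2 * a) (f (best f (trig f s u x) u) + dist u (best f (trig f s u x) u)) := by
      unfold charge; rw [if_pos ht]
    have hst : step f s u x = { F := insert (best f (trig f s u x) u) s.F
                                cr := fun v => if dist v (best f (trig f s u x) u) ≤ s.rad v then 0 else s.cr v
                                rad := s.rad } := by
      unfold step; rw [if_neg hF.ne_empty, if_pos ht]
    rw [hch, hst]
    set w := best f (trig f s u x) u with hw
    have hwu : dist u w ≤ a / x := by
      have h1 := hw1
      simp only [trig, Finset.mem_filter] at h1
      exact h1.2.1
    have hDn : connCost (insert w s.F) c ≤ Ds / K := by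
      have h4 := connCost_le c (Finset.mem_insert_self w s.F)
      have h5 := dist_triangle_left c w u
      linarith
    by_cases hc : c ∈ trig f s u x
    · refine ⟨f c, ?_, e + 1, Ds / K, ∅, hb1, hDn, hb2, by simp, by simp, by simpa using hf c, ?_⟩
      · exact (min_le_right _ _).trans (hw2 c hc)
      · push_cast
        simp only [Finset.sum_empty]
        linarith [hf c]
    · have := hcW hc
      refine ⟨2 * a, ?_, e + 1, Ds / K, ∅, hb1, hDn, hb2, by simp, by simp, by simpa using hf c, ?_⟩
      · exact (min_le_left _ _).trans (by linarith [@dist_nonneg _ _ u c])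
      · push_cast
        simp only [Finset.sum_empty]
        linarith [hf c]
  · have hc : c ∉ trig f s u x := fun hc => ht ⟨c, hc⟩
    have hlt := hcW hc
    have huE : u ∉ E := fun hv => hu (hE u hv).1
    have hch : charge f s u x = 2 * a := by unfold charge; rw [if_neg ht]
    have hst : step f s u x = { F := s.F
                                cr := Function.update s.cr u a
                                rad := Function.update s.rad u (a / x) } := by
      unfold step; rw [if_neg hF.ne_empty, if_neg ht]
    have hne : ∀ v ∈ E, v ≠ u := fun v hv hvu => hu (hvu ▸ (hE v hv).1)
    have hs : ∑ v ∈ insert u E, (Function.update s.cr u a) v = a + ∑ v ∈ E, s.cr v := by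
      rw [Finset.sum_insert huE, Function.update_self]
      congr 1
      exact Finset.sum_congr rfl fun v hv => Function.update_of_ne (hne v hv) _ _
    rw [hch, hst]
    refine ⟨2 * a, by linarith [@dist_nonneg _ _ u c], e, Ds, insert u E, heK, hD, hDM, ?_, fun _ => hMD, ?_, ?_⟩
    · intro v hv
      rcases Finset.mem_insert.mp hv with rfl | hv
      · simp [hgood, hrad]
      · simp only
        rw [Function.update_of_ne (hne v hv)]
        exact ⟨List.mem_cons_of_mem _ (hE v hv).1, (hE v hv).2⟩
    · simp only [hs]; linarith
    · simp only [hs]; linarith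

noncomputable def xx (n : ℕ) : ℝ := 4 * ((2 ^ (lev n + 1) : ℕ) : ℝ)

noncomputable def run (f : V → ℝ) : List V → OSt V
  | [] => ⟨∅, fun _ => 0, fun _ => 0⟩
  | u :: h => step f (run f h) u (xx (h.length + 1))

lemma step_F_subset (f : V → ℝ) (s : OSt V) (u : V) (x : ℝ) : s.F ⊆ (step f s u x).F := by
  unfold step
  split_ifs with h1 h2
  · rw [h1]; exact Finset.empty_subset _
  · exact Finset.subset_insert _ _
  · exact Finset.Subset.refl _

lemma step_F_nonempty (f : V → ℝ) (s : OSt V) (u : V) (x : ℝ) : (step f s u x).F.Nonempty := by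
  unfold step
  split_ifs with h1 h2
  · simp
  · simp
  · exact Finset.nonempty_iff_ne_empty.mpr h1

lemma run_F_nonempty (f : V → ℝ) {h : List V} (hh : h ≠ []) : (run f h).F.Nonempty := by
  cases h with
  | nil => exact absurd rfl hh
  | cons u h => exact step_F_nonempty _ _ _ _

lemma run_cr_nonneg (f : V → ℝ) (h : List V) (v : V) : 0 ≤ (run f h).cr v := by
  induction h with
  | nil => simp [run]
  | cons u h ih =>
    rw [run]
    unfold step
    split_ifs with h1 h2
    · exact ih
    · simp only
      split_ifs
      · exact le_rfl
      · exact ih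
    · simp only
      by_cases hv : v = u
      · subst hv; rw [Function.update_self]; exact connCost_nonneg _ _
      · rw [Function.update_of_ne hv]; exact ih

lemma run_cr_zero (f : V → ℝ) (h : List V) (v : V) (hv : v ∉ h) : (run f h).cr v = 0 := by
  induction h with
  | nil => simp [run]
  | cons u h ih =>
    simp only [List.mem_cons, not_or] at hv
    rw [run]
    unfold step
    split_ifs with h1 h2
    · exact ih hv.2
    · simp only
      split_ifs
      · rfl
      · exact ih hv.2
    · simp only
      rw [Function.update_of_ne hv.1]; exact ih hv.2

noncomputable def Acl (asg : V → V) (c : V) : List V → ℝ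
  | [] => 0
  | u :: h => Acl asg c h + if asg u = c then dist u c else 0

noncomputable def cnt (k : ℕ) : List V → ℕ
  | [] => 0
  | _ :: h => cnt k h + if lev (h.length + 1) = k then 1 else 0

noncomputable def grp (f : V → ℝ) (asg : V → V) (c : V) (k : ℕ) : List V → ℝ
  | [] => 0
  | u :: h => grp f asg c k h +
      if h ≠ [] ∧ asg u = c ∧ lev (h.length + 1) = k then
        charge f (run f h) u (xx (h.length + 1)) else 0

lemma Acl_nonneg (asg : V → V) (c : V) (h : List V) : 0 ≤ Acl asg c h := by
  induction h with
  | nil => simp [Acl]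
  | cons u h ih =>
    rw [Acl]
    split_ifs
    · linarith [@dist_nonneg _ _ u c]
    · linarith

lemma cnt_le (k : ℕ) (h : List V) : cnt k h ≤ (2 ^ (k + 1)) ^ (2 ^ (k + 1)) ∧ cnt k h ≤ h.length := by
  induction h with
  | nil => simp [cnt]
  | cons u h ih =>
    rw [cnt]
    split_ifs with hk
    · have := lev_spec (h.length + 1)
      rw [hk] at this
      simp only [List.length_cons]
      omega
    · simp only [List.length_cons]
      omega

lemma grp_inv {f : V → ℝ} (hf : ∀ v, 0 ≤ f v) (asg : V → V) (c : V) (k : ℕ) (A M : ℝ)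
    (hM : M = f c + 2 * A) (h : List V) (hnd : h.Nodup) (hA : Acl asg c h ≤ A) :
    ∃ G : ℝ, grp f asg c k h ≤ 8 * ((2 ^ (k + 1) : ℕ) : ℝ) * Acl asg c h +
        cnt k h * (4 * M / (((2 ^ (k + 1) : ℕ) : ℝ) ^ (2 ^ (k + 1)))) + G ∧
      (G ≤ 0 ∨ (h ≠ [] ∧ Main f c (2 ^ (k + 1)) M (run f h) h G)) := by
  induction h with
  | nil => exact ⟨0, by simp [grp, Acl, cnt], Or.inl le_rfl⟩
  | cons u h ih =>
    rw [List.nodup_cons] at hnd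
    have hA' : Acl asg c h ≤ A := by
      rw [Acl] at hA
      split_ifs at hA
      · linarith [@dist_nonneg _ _ u c]
      · linarith
    have hA0 : 0 ≤ A := (Acl_nonneg _ _ _).trans hA'
    have hM0 : 0 ≤ M := by rw [hM]; linarith [hf c]
    obtain ⟨G, hG, hm⟩ := ih hnd.2 hA'
    set K : ℕ := 2 ^ (k + 1) with hKdef
    have hK1 : 1 ≤ K := Nat.one_le_two_pow
    have hK' : (1 : ℝ) ≤ K := by exact_mod_cast hK1
    have hN : (0 : ℝ) < (K : ℝ) ^ K := by positivity
    have hq : 0 ≤ 4 * M / (K : ℝ) ^ K := by positivity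
    set q := 4 * M / (K : ℝ) ^ K with hqdef
    -- the step that adds nothing to the third component
    have other : ∀ G : ℝ, (G ≤ 0 ∨ (h ≠ [] ∧ Main f c K M (run f h) h G)) →
        (G ≤ 0 ∨ (u :: h ≠ [] ∧ Main f c K M (run f (u :: h)) (u :: h) G)) := by
      intro G hm
      rcases hm with h0 | ⟨hne, hm⟩
      · exact Or.inl h0
      · refine Or.inr ⟨by simp, ?_⟩
        rw [run]
        exact main_step_other hf hK1 hm (run_F_nonempty f hne) hnd.1
    by_cases hp : h ≠ [] ∧ asg u = c ∧ lev (h.length + 1) = k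
    swap
    · refine ⟨G, ?_, other G hm⟩
      rw [grp, if_neg hp, Acl, cnt]
      have h1 : (0:ℝ) ≤ if asg u = c then dist u c else 0 := by
        split_ifs
        · exact dist_nonneg
        · exact le_rfl
      have h2 : (cnt k h : ℝ) ≤ ((cnt k h + if lev (h.length + 1) = k then 1 else 0 : ℕ) : ℝ) := by
        exact_mod_cast Nat.le_add_right _ _
      have h3 := mul_le_mul_of_nonneg_right h2 hq
      have h4 : (0:ℝ) ≤ 8 * K * (if asg u = c then dist u c else 0) := by positivity
      rw [mul_add]
      linarith
    · obtain ⟨hne, hasg, hlev⟩ := hp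
      have hF := run_F_nonempty f hne
      have hxx : xx (h.length + 1) = 4 * (K : ℝ) := by rw [xx, hlev]
      have hg : grp f asg c k (u :: h) = grp f asg c k h + charge f (run f h) u (4 * (K : ℝ)) := by
        rw [grp, if_pos ⟨hne, hasg, hlev⟩, hxx]
      have hAe : Acl asg c (u :: h) = Acl asg c h + dist u c := by
        rw [Acl, if_pos hasg]
      have hce : (cnt k (u :: h) : ℝ) = cnt k h + 1 := by
        rw [cnt, if_pos hlev]; push_cast; ring
      have hrun : run f (u :: h) = step f (run f h) u (4 * (K : ℝ)) := by rw [run, hxx]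
      have hd0 : 0 ≤ dist u c := dist_nonneg
      have hKd : dist u c ≤ K * dist u c := by nlinarith
      rw [hg, hAe, hce, mul_add, add_mul, one_mul]
      have hAd : dist u c ≤ A := by linarith [Acl_nonneg asg c h]
      have hch := charge_le f (run f h) u (4 * (K : ℝ))
      set a := connCost (run f h).F u with ha
      by_cases hbad : a / (4 * K) < dist u c
      · rw [div_lt_iff₀ (by positivity)] at hbad
        refine ⟨G, ?_, other G hm⟩
        linarith
      push Not at hbad
      by_cases htiny : (K : ℝ) ^ K * a ≤ 2 * M
      · refine ⟨G, ?_, other G hm⟩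
        have : 2 * a ≤ q := by
          rw [hqdef, le_div_iff₀ hN]; linarith
        have : 0 ≤ 8 * (K : ℝ) * dist u c := by positivity
        linarith
      push Not at htiny
      -- a significant client
      have fin : ∀ G0 : ℝ, G ≤ G0 → Main f c K M (run f h) h G0 → ∃ G' : ℝ,
          grp f asg c k h + charge f (run f h) u (4 * (K : ℝ)) ≤
            8 * ↑K * Acl asg c h + 8 * ↑K * dist u c + (↑(cnt k h) * q + q) + G' ∧
          (G' ≤ 0 ∨ u :: h ≠ [] ∧ Main f c K M (run f (u :: h)) (u :: h) G') := by
        intro G0 hG0 hmain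
        obtain ⟨δ, hδ, hm'⟩ := main_step_good hf hK1 rfl hmain hF hnd.1 (run_cr_nonneg f h) hbad htiny
        refine ⟨G0 + δ, ?_, Or.inr ⟨by simp, hrun ▸ hm'⟩⟩
        linarith
      rcases hm with h0 | ⟨_, hm⟩
      swap
      · exact fin G le_rfl hm
      by_cases hc : c ∈ trig f (run f h) u (4 * (K : ℝ))
      · have ht : (trig f (run f h) u (4 * (K : ℝ))).Nonempty := ⟨c, hc⟩
        obtain ⟨hw1, hw2⟩ := best_spec f _ u ht
        have hch : charge f (run f h) u (4 * (K : ℝ)) ≤ f c + dist u c := by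
          unfold charge
          rw [if_pos ht]
          exact (min_le_right _ _).trans (hw2 c hc)
        refine ⟨f c, by linarith, Or.inr ⟨by simp, ?_⟩⟩
        rw [hrun]
        refine ⟨0, M, ∅, by simp, ?_, by simp, by simp, by simp, by simpa using hf c, ?_⟩
        · unfold step
          rw [if_neg hF.ne_empty, if_pos ht]
          have h4 := connCost_le c (Finset.mem_insert_self (best f (trig f (run f h) u (4 * (K : ℝ))) u) (run f h).F)
          have h5 := dist_triangle_left c (best f (trig f (run f h) u (4 * (K : ℝ))) u) u
          have h6 := hw2 c hc
          have h7 := hf (best f (trig f (run f h) u (4 * (K : ℝ))) u)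
          simp only
          linarith
        · simp only [Finset.sum_empty]
          push_cast
          linarith [hf c]
      · have hc' := hc
        simp only [trig, Finset.mem_filter, Finset.mem_univ, true_and, not_and, not_le] at hc'
        have h1 := hc' hbad
        have h2 := pot_ge (run_cr_nonneg f h) (c := c) ∅ (by simp)
        simp only [Finset.sum_empty] at h2
        have h3 := connCost_tri c u hF
        rw [dist_comm c u] at h3
        refine fin 0 h0 ⟨0, M, ∅, by simp, by linarith, by simp, by simp, by simp, by simpa using hf c, ?_⟩
        simp only [Finset.sum_empty]
        push_cast
        linarith [hf c]

lemma grp_bound {f : V → ℝ} (hf : ∀ v, 0 ≤ f v) (asg : V → V) (c : V) (k : ℕ)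
    (h : List V) (hnd : h.Nodup) :
    grp f asg c k h ≤ 16 * ((2 ^ (k + 1) : ℕ) : ℝ) * (f c + Acl asg c h) := by
  obtain ⟨G, hG, hm⟩ := grp_inv hf asg c k (Acl asg c h) _ rfl h hnd le_rfl
  set K : ℕ := 2 ^ (k + 1) with hKdef
  have hK1 : 1 ≤ K := Nat.one_le_two_pow
  have hK' : (1 : ℝ) ≤ K := by exact_mod_cast hK1
  have hN : (0 : ℝ) < (K : ℝ) ^ K := by positivity
  have hA0 := Acl_nonneg asg c h
  have hc := (cnt_le k h).1
  rw [← hKdef] at hc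
  have hc' : (cnt k h : ℝ) ≤ (K : ℝ) ^ K := by exact_mod_cast hc
  have h1 : (cnt k h : ℝ) * (4 * (f c + 2 * Acl asg c h) / (K : ℝ) ^ K) ≤ 4 * (f c + 2 * Acl asg c h) := by
    rw [mul_div_assoc', div_le_iff₀ hN, mul_comm]
    have := hf c
    gcongr
  have h2 : G ≤ 4 * f c + 4 * f c * K := by
    rcases hm with h0 | ⟨_, e, Ds, E, heK, hD, hDM, hE, hEn, hEs, hGe⟩
    · have := hf c
      have : 0 ≤ 4 * f c * K := by positivity
      linarith
    · have : (e : ℝ) ≤ K := by exact_mod_cast heK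
      have : 4 * f c * e ≤ 4 * f c * K := by
        have := hf c
        gcongr
      linarith
  have h3 : f c ≤ K * f c := by nlinarith [hf c]
  have h4 : Acl asg c h ≤ K * Acl asg c h := by nlinarith
  have h5 : 0 ≤ K * f c := mul_nonneg (by linarith) (hf c)
  linarith

lemma step_cost {f : V → ℝ} (hf : ∀ v, 0 ≤ f v) {s : OSt V} (hF : s.F.Nonempty) {u : V} {x : ℝ}
    (hx : 1 ≤ x) (hcr : ∀ v, 0 ≤ s.cr v) (hu : s.cr u = 0) :
    ∑ v ∈ (step f s u x).F \ s.F, f v + connCost (step f s u x).F u + ∑ v, (step f s u x).cr v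
      ≤ ∑ v, s.cr v + charge f s u x := by
  unfold step charge
  rw [if_neg hF.ne_empty]
  split_ifs with ht
  · obtain ⟨hw1, hw2⟩ := best_spec f _ u ht
    set w := best f (trig f s u x) u with hw
    simp only [trig, Finset.mem_filter, Finset.mem_univ, true_and] at hw1
    obtain ⟨hd, hfw⟩ := hw1
    have ha0 : 0 ≤ connCost s.F u := connCost_nonneg _ _
    have hax : connCost s.F u / x ≤ connCost s.F u := div_le_self ha0 hx
    have h1 : ∑ v ∈ insert w s.F \ s.F, f v ≤ f w := by
      calc _ ≤ ∑ v ∈ {w}, f v := by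
            refine Finset.sum_le_sum_of_subset_of_nonneg ?_ (fun i _ _ => hf i)
            intro v hv
            simp only [Finset.mem_sdiff, Finset.mem_insert] at hv
            simp only [Finset.mem_singleton]
            tauto
        _ = f w := by simp
    have h2 := connCost_le u (Finset.mem_insert_self w s.F)
    have h3 : ∑ v, (if dist v w ≤ s.rad v then 0 else s.cr v) = ∑ v, s.cr v - pot s w := by
      rw [pot, ← Finset.sum_sub_distrib]
      refine Finset.sum_congr rfl fun v _ => ?_
      split_ifs <;> ring
    have h4 := pot_ge hcr (c := w) ∅ (by simp)
    simp only [Finset.sum_empty] at h4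
    simp only
    rw [h3]
    rcases le_total (2 * connCost s.F u) (f w + dist u w) with h | h
    · rw [min_eq_left h]; linarith
    · rw [min_eq_right h]; linarith
  · have : ∑ v, Function.update s.cr u (connCost s.F u) v = connCost s.F u + ∑ v, s.cr v := by
      rw [Finset.sum_update_of_mem (Finset.mem_univ u)]
      congr 1
      rw [← Finset.sum_sdiff (Finset.subset_univ {u})]
      simp [hu]
    simp only
    rw [this]
    simp
    linarith

lemma one_le_xx (n : ℕ) : 1 ≤ xx n := by
  unfold xx
  have : 1 ≤ 2 ^ (lev n + 1) := Nat.one_le_two_pow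
  have : (1 : ℝ) ≤ ((2 ^ (lev n + 1) : ℕ) : ℝ) := by exact_mod_cast this
  linarith

lemma total_bound {f : V → ℝ} (hf : ∀ v, 0 ≤ f v) (T : Finset V) (asg : V → V)
    (hasg : ∀ u, asg u ∈ T) (R : ℝ) (hR0 : 0 ≤ R) (m : ℕ)
    (h : List V) (hR : ∀ u ∈ h, f (asg u) + dist u (asg u) ≤ R) (hnd : h.Nodup) (hm : lev h.length < m) :
    hcost f (fun h => (run f h).F) h + ∑ v, (run f h).cr v ≤
      R + ∑ k ∈ Finset.range m, ∑ c ∈ T, grp f asg c k h := by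
  induction h with
  | nil => simpa [hcost, run, grp] using hR0
  | cons u h ih =>
    rw [List.nodup_cons] at hnd
    have hm' : lev h.length < m := (lev_mono (by simp)).trans_lt hm
    have ih' := ih (fun v hv => hR v (List.mem_cons_of_mem _ hv)) hnd.2 hm'
    by_cases hne : h = []
    · subst hne
      have hg : ∀ c k, grp f asg c k [u] = 0 := by intro c k; simp [grp]
      simp only [hg, Finset.sum_const_zero, add_zero]
      refine le_trans ?_ (hR u (by simp))
      have := (best_spec f Finset.univ u ⟨u, Finset.mem_univ u⟩).2 (asg u) (Finset.mem_univ _)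
      have h2 := connCost_le u (Finset.mem_singleton_self (best f Finset.univ u))
      simp only [hcost, run, step, if_true, Finset.sum_empty, Finset.sdiff_empty, Finset.sum_singleton,
        Finset.sum_const_zero]
      linarith
    · have hg : ∀ c k, grp f asg c k (u :: h) = grp f asg c k h +
          if k = lev (h.length + 1) then (if c = asg u then charge f (run f h) u (xx (h.length + 1)) else 0) else 0 := by
        intro c k
        rw [grp]
        congr 1
        by_cases h1 : asg u = c <;> by_cases h2 : lev (h.length + 1) = k <;>
          simp [hne, h1, h2, eq_comm] <;> simp_all [eq_comm]
      simp only [hg, Finset.sum_add_distrib]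
      have e : ∑ k ∈ Finset.range m, ∑ c ∈ T, (if k = lev (h.length + 1) then
          (if c = asg u then charge f (run f h) u (xx (h.length + 1)) else 0) else 0) =
          charge f (run f h) u (xx (h.length + 1)) := by
        rw [Finset.sum_eq_single (lev (h.length + 1))]
        · simp [hasg u]
        · intro k _ hk; simp [hk]
        · intro hk; exact absurd (Finset.mem_range.mpr hm) hk
      rw [e, hcost]
      have := step_cost hf (run_F_nonempty f hne) (one_le_xx (h.length + 1)) (run_cr_nonneg f h)
        (run_cr_zero f h u hnd.1)
      rw [run]
      linarith

lemma Acl_sum (asg : V → V) (T : Finset V) (hasg : ∀ u, asg u ∈ T)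
    (hc : ∀ u, connCost T u = dist u (asg u)) (h : List V) (hnd : h.Nodup) :
    ∑ c ∈ T, Acl asg c h = ∑ u ∈ h.toFinset, connCost T u := by
  induction h with
  | nil => simp [Acl]
  | cons u h ih =>
    rw [List.nodup_cons] at hnd
    simp only [Acl, Finset.sum_add_distrib]
    rw [ih hnd.2, List.toFinset_cons, Finset.sum_insert (by simpa using hnd.1), hc u, add_comm]
    congr 1
    rw [Finset.sum_ite_eq]
    simp [hasg u]

lemma sum_two_pow (m : ℕ) : ∑ k ∈ Finset.range m, ((2 ^ (k + 1) : ℕ) : ℝ) ≤ 2 * 2 ^ m := by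
  induction m with
  | zero => simp
  | succ m ih =>
    rw [Finset.sum_range_succ]
    push_cast at *
    rw [pow_succ (2:ℝ) m]
    linarith

lemma base_alg {f : V → ℝ} (hf : ∀ v, 0 ≤ f v) : ∃ G : List V → Finset V,
    (∀ x h, G h ⊆ G (x :: h)) ∧ (∀ x h, (G (x :: h)).Nonempty) ∧ G [] = ∅ ∧
    ∀ h : List V, h.Nodup → hcost f G h ≤ 65 * 2 ^ (lev h.length) * flOpt f h.toFinset := by
  refine ⟨fun h => (run f h).F, fun x h => step_F_subset _ _ _ _, fun x h => step_F_nonempty _ _ _ _,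
    rfl, ?_⟩
  intro h hnd
  rcases h with _ | ⟨u0, h0⟩
  · have := flOpt_nonneg hf (([] : List V).toFinset)
    simp only [hcost, run, Finset.sum_empty]
    positivity
  have : Nonempty V := ⟨u0⟩
  set h := u0 :: h0 with hh
  clear_value h
  obtain ⟨T, hT, e⟩ := flOpt_exists f h.toFinset
  have hex : ∀ u : V, ∃ v ∈ T, connCost T u = dist u v := fun u => connCost_exists u hT
  choose asg hasg hc using hex
  have hR0 : 0 ≤ flOpt f h.toFinset := flOpt_nonneg hf _
  have hR : ∀ u ∈ h, f (asg u) + dist u (asg u) ≤ flOpt f h.toFinset := by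
    intro u hu
    rw [e, flCost]
    have h1 : f (asg u) ≤ ∑ v ∈ T, f v := Finset.single_le_sum (fun i _ => hf i) (hasg u)
    have h2 : connCost T u ≤ ∑ a ∈ h.toFinset, connCost T a :=
      Finset.single_le_sum (f := connCost T) (fun i _ => connCost_nonneg T i) (by simpa using hu)
    rw [hc u] at h2
    linarith
  have h1 := total_bound hf T asg hasg _ hR0 (lev h.length + 1) h hR hnd (Nat.lt_succ_self _)
  have h2 : 0 ≤ ∑ v, (run f h).cr v := Finset.sum_nonneg fun v _ => run_cr_nonneg f h v
  have h3 : ∑ k ∈ Finset.range (lev h.length + 1), ∑ c ∈ T, grp f asg c k h ≤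
      ∑ k ∈ Finset.range (lev h.length + 1), 16 * ((2 ^ (k + 1) : ℕ) : ℝ) * flOpt f h.toFinset := by
    refine Finset.sum_le_sum fun k _ => ?_
    calc _ ≤ ∑ c ∈ T, 16 * ((2 ^ (k + 1) : ℕ) : ℝ) * (f c + Acl asg c h) :=
          Finset.sum_le_sum fun c _ => grp_bound hf asg c k h hnd
      _ = _ := by
        rw [← Finset.mul_sum, Finset.sum_add_distrib, Acl_sum asg T hasg hc h hnd, e, flCost]
  rw [← Finset.sum_mul, ← Finset.mul_sum] at h3
  have h4 := sum_two_pow (lev h.length + 1)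
  rw [pow_succ] at h4
  have h5 := mul_le_mul_of_nonneg_right h4 hR0
  have h6 : (1:ℝ) ≤ 2 ^ lev h.length := one_le_pow₀ (by norm_num)
  have h7 := mul_le_mul_of_nonneg_right h6 hR0
  linarith

def Cand (f : V → ℝ) (Xhat : Finset V) (B : ℝ) (p : Finset V × Finset V) : Prop :=
  p.2 ⊆ Xhat ∧ flCost f p.1 p.2 ≤ B ∧ (p.2.Nonempty → p.1.Nonempty)

lemma exists_sol (f : V → ℝ) (Xhat : Finset V) (B : ℝ) :
    ∃ p : Finset V × Finset V, 0 ≤ B → Cand f Xhat B p ∧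
      ∀ p', Cand f Xhat B p' → p'.2.card ≤ p.2.card := by
  classical
  by_cases hB : 0 ≤ B
  · have hne : (Finset.univ.filter (Cand f Xhat B)).Nonempty :=
      ⟨(∅, ∅), by simp [Cand, flCost, hB]⟩
    obtain ⟨p, hp, hm⟩ := Finset.exists_max_image _ (fun p : Finset V × Finset V => p.2.card) hne
    refine ⟨p, fun _ => ⟨(Finset.mem_filter.mp hp).2, fun p' hp' => hm p' ?_⟩⟩
    simp [hp']
  · exact ⟨(∅, ∅), fun h => absurd h hB⟩

noncomputable def sol (f : V → ℝ) (Xhat : Finset V) (B : ℝ) : Finset V × Finset V :=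
  (exists_sol f Xhat B).choose

lemma sol_spec (f : V → ℝ) (Xhat : Finset V) {B : ℝ} (hB : 0 ≤ B) :
    Cand f Xhat B (sol f Xhat B) ∧ ∀ p', Cand f Xhat B p' → p'.2.card ≤ (sol f Xhat B).2.card :=
  (exists_sol f Xhat B).choose_spec hB

structure WSt (V : Type) where
  B : ℝ
  q : List V
  F : Finset V

open Classical in
noncomputable def wstep (f : V → ℝ) (Xhat : Finset V) (G : List V → Finset V) (s : WSt V) (x : V) :
    WSt V :=
  if x ∈ (sol f Xhat s.B).2 then s
  else if hcost f G (x :: s.q) ≤ s.B then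
    { B := s.B, q := x :: s.q, F := s.F ∪ G (x :: s.q) }
  else
    { B := 2 * max s.B (f (best f Finset.univ x) + dist x (best f Finset.univ x))
      q := []
      F := s.F ∪ ({best f Finset.univ x} ∪
        (sol f Xhat (2 * max s.B (f (best f Finset.univ x) + dist x (best f Finset.univ x)))).1) }

noncomputable def wrun (f : V → ℝ) (Xhat : Finset V) (G : List V → Finset V) : List V → WSt V
  | [] => ⟨0, [], (sol f Xhat 0).1⟩
  | x :: h => wstep f Xhat G (wrun f Xhat G h) x

/-- Why the budget has its present value. -/
def Why (f : V → ℝ) (Xhat : Finset V) (G : List V → Finset V) (h : List V) (B : ℝ) : Prop :=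
  B = 0 ∨ ∃ (B0 : ℝ) (x : V) (q : List V), 0 ≤ B0 ∧ x ∈ h ∧
    B = 2 * max B0 (f (best f Finset.univ x) + dist x (best f Finset.univ x)) ∧
    (x :: q).Nodup ∧ (∀ v ∈ x :: q, v ∈ h ∧ v ∉ (sol f Xhat B0).2) ∧ B0 < hcost f G (x :: q)

lemma sum_sdiff_union_le {f : V → ℝ} (hf : ∀ v, 0 ≤ f v) (A S S' : Finset V) (hS : S ⊆ A) :
    ∑ v ∈ (A ∪ S') \ A, f v ≤ ∑ v ∈ S' \ S, f v := by
  refine Finset.sum_le_sum_of_subset_of_nonneg ?_ (fun i _ _ => hf i)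
  intro v hv
  simp only [Finset.mem_sdiff, Finset.mem_union] at *
  exact ⟨by tauto, fun h => hv.2 (hS h)⟩

lemma wrun_inv {f : V → ℝ} (hf : ∀ v, 0 ≤ f v) (Xhat : Finset V) (G : List V → Finset V)
    (hGm : ∀ x h, G h ⊆ G (x :: h)) (hGn : ∀ x h, (G (x :: h)).Nonempty) (hG0 : G [] = ∅)
    (h : List V) (hnd : h.Nodup) :
    let s := wrun f Xhat G h
    0 ≤ s.B ∧ s.q.Nodup ∧ (∀ v ∈ s.q, v ∈ h ∧ v ∉ (sol f Xhat s.B).2) ∧ hcost f G s.q ≤ s.B ∧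
    (sol f Xhat s.B).1 ⊆ s.F ∧ G s.q ⊆ s.F ∧ Why f Xhat G h s.B ∧ (h ≠ [] → s.F.Nonempty) ∧
    hcost f (fun h => (wrun f Xhat G h).F) h ≤ 3 * s.B + ∑ v ∈ (sol f Xhat s.B).1, f v +
      ∑ v ∈ (sol f Xhat s.B).2 ∩ h.toFinset, connCost (sol f Xhat s.B).1 v + hcost f G s.q := by
  induction h with
  | nil =>
    simp only [wrun]
    refine ⟨le_rfl, by simp, by simp, by simp [hcost, hG0], subset_rfl, by simp [hG0], Or.inl rfl,
      by simp, ?_⟩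
    simp [hcost, hG0, wrun]
  | cons x h ih =>
    rw [List.nodup_cons] at hnd
    obtain ⟨hB, hqn, hq, hqc, hS, hGq, hW, hFn, hc⟩ := ih hnd.2
    obtain ⟨⟨hs1, hs2, hs3⟩, hs4⟩ := sol_spec f Xhat hB
    set s := wrun f Xhat G h with hs
    have hW' : ∀ B, Why f Xhat G h B → Why f Xhat G (x :: h) B := by
      rintro B (h0 | ⟨B0, y, q, h1, h2, h3, h4, h5, h6⟩)
      · exact Or.inl h0
      · exact Or.inr ⟨B0, y, q, h1, List.mem_cons_of_mem _ h2, h3, h4,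
          fun v hv => ⟨List.mem_cons_of_mem _ (h5 v hv).1, (h5 v hv).2⟩, h6⟩
    have hq' : ∀ v ∈ s.q, v ∈ x :: h ∧ v ∉ (sol f Xhat s.B).2 :=
      fun v hv => ⟨List.mem_cons_of_mem _ (hq v hv).1, (hq v hv).2⟩
    have hxq : x ∉ s.q := fun hx => hnd.1 (hq x hx).1
    have hmon : ∑ v ∈ (sol f Xhat s.B).2 ∩ h.toFinset, connCost (sol f Xhat s.B).1 v ≤
        ∑ v ∈ (sol f Xhat s.B).2 ∩ (x :: h).toFinset, connCost (sol f Xhat s.B).1 v := by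
      refine Finset.sum_le_sum_of_subset_of_nonneg ?_ (fun i _ _ => connCost_nonneg _ _)
      refine Finset.inter_subset_inter_left ?_
      rw [List.toFinset_cons]; exact Finset.subset_insert _ _
    by_cases hx : x ∈ (sol f Xhat s.B).2
    · have e : wrun f Xhat G (x :: h) = s := by
        rw [wrun, wstep, if_pos hx]
      have hSn := hs3 ⟨x, hx⟩
      simp only [e]
      refine ⟨hB, hqn, hq', hqc, hS, hGq, hW' _ hW, fun _ => hSn.mono hS, ?_⟩
      rw [hcost]
      simp only [e, ← hs, Finset.sdiff_self, Finset.sum_empty, add_zero]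
      have e2 : (sol f Xhat s.B).2 ∩ (x :: h).toFinset = insert x ((sol f Xhat s.B).2 ∩ h.toFinset) := by
        rw [List.toFinset_cons, Finset.inter_insert_of_mem hx]
      rw [e2, Finset.sum_insert (by simp [hnd.1])]
      have := connCost_anti x hSn hS
      linarith
    · by_cases hcst : hcost f G (x :: s.q) ≤ s.B
      · have e : wrun f Xhat G (x :: h) = { B := s.B, q := x :: s.q, F := s.F ∪ G (x :: s.q) } := by
          rw [wrun, wstep, if_neg hx, if_pos hcst]
        simp only [e]
        refine ⟨hB, List.nodup_cons.mpr ⟨hxq, hqn⟩, ?_, hcst, hS.trans Finset.subset_union_left,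
          Finset.subset_union_right, hW' _ hW, fun _ => (hGn _ _).mono Finset.subset_union_right, ?_⟩
        · intro v hv
          rcases List.mem_cons.mp hv with rfl | hv
          · exact ⟨by simp, hx⟩
          · exact hq' v hv
        · rw [hcost]
          simp only [e, ← hs]
          rw [hcost]
          have h1 := sum_sdiff_union_le hf s.F (G s.q) (G (x :: s.q)) hGq
          have h2 := connCost_anti (T := s.F ∪ G (x :: s.q)) x (hGn x s.q) Finset.subset_union_right
          linarith
      · set o := f (best f Finset.univ x) + dist x (best f Finset.univ x) with ho
        have e : wrun f Xhat G (x :: h) = {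
            B := 2 * max s.B o
            q := []
            F := s.F ∪ ({best f Finset.univ x} ∪ (sol f Xhat (2 * max s.B o)).1) } := by
          rw [wrun, wstep, if_neg hx, if_neg hcst]
        have ho0 : 0 ≤ o := add_nonneg (hf _) dist_nonneg
        have hm1 : s.B ≤ max s.B o := le_max_left _ _
        have hm2 : o ≤ max s.B o := le_max_right _ _
        simp only [e]
        refine ⟨by linarith, by simp, by simp, ?_, ?_, by simp [hG0], ?_, fun _ => by simp, ?_⟩
        · simp only [hcost, hG0, Finset.sum_empty]; linarith
        · exact Finset.subset_union_right.trans Finset.subset_union_right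
        · refine Or.inr ⟨s.B, x, s.q, hB, by simp, rfl, List.nodup_cons.mpr ⟨hxq, hqn⟩, ?_,
            not_le.mp hcst⟩
          intro v hv
          rcases List.mem_cons.mp hv with rfl | hv
          · exact ⟨by simp, hx⟩
          · exact hq' v hv
        · have h6 : hcost f G [] = 0 := by simp [hcost, hG0]
          rw [h6, hcost]
          simp only [e, ← hs]
          have h1 := sum_sdiff_union_le hf s.F ∅ ({best f Finset.univ x} ∪ (sol f Xhat (2 * max s.B o)).1)
            (Finset.empty_subset _)
          rw [Finset.sdiff_empty] at h1
          have h2 : ∑ v ∈ {best f Finset.univ x} ∪ (sol f Xhat (2 * max s.B o)).1, f v ≤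
              f (best f Finset.univ x) + ∑ v ∈ (sol f Xhat (2 * max s.B o)).1, f v := by
            have := Finset.sum_union_inter (s₁ := {best f Finset.univ x})
              (s₂ := (sol f Xhat (2 * max s.B o)).1) (f := f)
            have h3 : 0 ≤ ∑ v ∈ {best f Finset.univ x} ∩ (sol f Xhat (2 * max s.B o)).1, f v :=
              Finset.sum_nonneg fun v _ => hf v
            rw [Finset.sum_singleton] at this
            linarith
          have h3 : connCost (s.F ∪ ({best f Finset.univ x} ∪ (sol f Xhat (2 * max s.B o)).1)) x ≤
              dist x (best f Finset.univ x) := connCost_le x (by simp)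
          have h4 : ∑ v ∈ (sol f Xhat s.B).1, f v +
              ∑ v ∈ (sol f Xhat s.B).2 ∩ h.toFinset, connCost (sol f Xhat s.B).1 v ≤ s.B := by
            refine le_trans ?_ hs2
            unfold flCost
            gcongr
            · exact fun i _ _ => connCost_nonneg _ _
            · exact Finset.inter_subset_left
          have h5 : 0 ≤ ∑ v ∈ (sol f Xhat (2 * max s.B o)).2 ∩ (x :: h).toFinset,
              connCost (sol f Xhat (2 * max s.B o)).1 v :=
            Finset.sum_nonneg fun v _ => connCost_nonneg _ _
          linarith

lemma wstep_subset (f : V → ℝ) (Xhat : Finset V) (G : List V → Finset V) (s : WSt V) (x : V) :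
    s.F ⊆ (wstep f Xhat G s x).F := by
  unfold wstep
  split_ifs
  · exact subset_rfl
  · exact Finset.subset_union_left
  · exact Finset.subset_union_left

lemma wrun_nonempty {f : V → ℝ} (Xhat : Finset V) (G : List V → Finset V)
    (hGn : ∀ x h, (G (x :: h)).Nonempty) (x : V) (h : List V)
    (hB : ∀ h, 0 ≤ (wrun f Xhat G h).B) (hS : ∀ h, (sol f Xhat (wrun f Xhat G h).B).1 ⊆ (wrun f Xhat G h).F) :
    (wrun f Xhat G (x :: h)).F.Nonempty := by
  rw [wrun]
  have h1 := hS h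
  obtain ⟨⟨hs1, hs2, hs3⟩, hs4⟩ := sol_spec f Xhat (hB h)
  unfold wstep
  split_ifs with hx
  · exact (hs3 ⟨x, hx⟩).mono h1
  · exact (hGn _ _).mono Finset.subset_union_right
  · simp

lemma wrun_B {f : V → ℝ} (hf : ∀ v, 0 ≤ f v) (Xhat : Finset V) (G : List V → Finset V) (h : List V) :
    0 ≤ (wrun f Xhat G h).B ∧ (sol f Xhat (wrun f Xhat G h).B).1 ⊆ (wrun f Xhat G h).F := by
  induction h with
  | nil => exact ⟨le_rfl, subset_rfl⟩
  | cons x h ih =>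
    rw [wrun]
    unfold wstep
    split_ifs with hx hc
    · exact ih
    · exact ⟨ih.1, ih.2.trans Finset.subset_union_left⟩
    · refine ⟨?_, Finset.subset_union_right.trans Finset.subset_union_right⟩
      have := le_max_left (wrun f Xhat G h).B (f (best f Finset.univ x) + dist x (best f Finset.univ x))
      simp only
      linarith [ih.1]

lemma best_le_opt {f : V → ℝ} (hf : ∀ v, 0 ≤ f v) {A : Finset V} {x : V} (hx : x ∈ A) :
    f (best f Finset.univ x) + dist x (best f Finset.univ x) ≤ flOpt f A := by
  have : Nonempty V := ⟨x⟩
  obtain ⟨T, hT, e⟩ := flOpt_exists f A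
  obtain ⟨v, hv, e2⟩ := connCost_exists x hT
  have h1 : f v ≤ ∑ v ∈ T, f v := Finset.single_le_sum (fun i _ => hf i) hv
  have h2 : connCost T x ≤ ∑ a ∈ A, connCost T a :=
    Finset.single_le_sum (f := connCost T) (fun i _ => connCost_nonneg T i) hx
  have h3 := (best_spec f Finset.univ x ⟨x, Finset.mem_univ x⟩).2 v (Finset.mem_univ v)
  rw [e, flCost]
  linarith

lemma why_bound {f : V → ℝ} (hf : ∀ v, 0 ≤ f v) (Xhat : Finset V) (G : List V → Finset V)
    (hG : ∀ h : List V, h.Nodup → hcost f G h ≤ 65 * 2 ^ (lev h.length) * flOpt f h.toFinset)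
    (h : List V) (B : ℝ) (hW : Why f Xhat G h B) :
    B ≤ 130 * 2 ^ (lev (predErr Xhat h)) * flOpt f h.toFinset := by
  have hO := flOpt_nonneg hf h.toFinset
  rcases hW with rfl | ⟨B0, x, q, hB0, hx, rfl, hnd, hq, hlt⟩
  · positivity
  have hp : (1:ℝ) ≤ 2 ^ (lev (predErr Xhat h)) := one_le_pow₀ (by norm_num)
  have h1 : flOpt f h.toFinset ≤ 2 ^ (lev (predErr Xhat h)) * flOpt f h.toFinset := by nlinarith
  have hb := best_le_opt hf (A := h.toFinset) (x := x) (by simpa using hx)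
  have : max B0 (f (best f Finset.univ x) + dist x (best f Finset.univ x)) ≤
      65 * 2 ^ (lev (predErr Xhat h)) * flOpt f h.toFinset := by
    refine max_le ?_ (by linarith)
    by_cases hOB : flOpt f h.toFinset ≤ B0
    swap
    · linarith
    have : Nonempty V := ⟨x⟩
    obtain ⟨⟨hs1, hs2, hs3⟩, hs4⟩ := sol_spec f Xhat hB0
    obtain ⟨T, hT, e⟩ := flOpt_exists f h.toFinset
    have hcard := hs4 (T, h.toFinset ∩ Xhat) ⟨Finset.inter_subset_right,
      ((flCost_mono f T Finset.inter_subset_left).trans e.ge).trans hOB, fun _ => hT⟩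
    simp only at hcard
    have hsub : (x :: q).toFinset ⊆ h.toFinset := by
      intro v hv
      rw [List.mem_toFinset] at *
      exact (hq v hv).1
    have hsub2 : (x :: q).toFinset ⊆ (h.toFinset \ Xhat) ∪ (Xhat \ (sol f Xhat B0).2) := by
      intro v hv
      rw [List.mem_toFinset] at hv
      have := hq v hv
      simp only [Finset.mem_union, Finset.mem_sdiff, List.mem_toFinset]
      tauto
    have hlen : (x :: q).length = (x :: q).toFinset.card := (List.toFinset_card_of_nodup hnd).symm
    have hle : (x :: q).length ≤ predErr Xhat h := by
      rw [hlen, predErr]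
      refine le_min (Finset.card_le_card hsub) ?_
      have c1 := (Finset.card_le_card hsub2).trans (Finset.card_union_le _ _)
      have c2 := Finset.card_sdiff_add_card_eq_card hs1
      have c3 := Finset.card_sdiff_add_card_inter Xhat h.toFinset
      rw [Finset.inter_comm] at c3
      omega
    have h2 := hG _ hnd
    have h3 := flOpt_mono hf hsub
    have h4 : (2:ℝ) ^ lev (x :: q).length ≤ 2 ^ lev (predErr Xhat h) :=
      pow_le_pow_right₀ (by norm_num) (lev_mono hle)
    calc B0 ≤ _ := hlt.le
      _ ≤ _ := h2
      _ ≤ _ := by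
        gcongr
        exact flOpt_nonneg hf _
  linarith

lemma pred_alg {f : V → ℝ} (hf : ∀ v, 0 ≤ f v) (Xhat : Finset V) :
    ∃ ALG : List V → Finset V, FLOnlineAlg ALG ∧
      ∀ σ : List V, σ.Nodup → σ ≠ [] →
        flAlgCost f ALG σ ≤ 650 * 2 ^ (lev (predErr Xhat σ)) * flOpt f σ.toFinset := by
  obtain ⟨G, hGm, hGn, hG0, hG⟩ := base_alg hf
  refine ⟨fun σ => (wrun f Xhat G σ.reverse).F, ⟨?_, ?_⟩, ?_⟩
  · intro σ x
    simp only [List.reverse_append, List.reverse_cons, List.reverse_nil, List.nil_append,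
      List.cons_append]
    rw [wrun]
    exact wstep_subset _ _ _ _ _
  · intro σ hσ
    have : σ.reverse ≠ [] := by simpa using hσ
    obtain ⟨x, h, e⟩ := List.exists_cons_of_ne_nil this
    simp only [e]
    exact wrun_nonempty Xhat G hGn x h (fun h => (wrun_B hf Xhat G h).1) (fun h => (wrun_B hf Xhat G h).2)
  · intro σ hnd hσ
    have e := flAlgCost_eq f (fun h => (wrun f Xhat G h).F)
      (fun x h => wstep_subset f Xhat G (wrun f Xhat G h) x) σ.reverse
    rw [List.reverse_reverse] at e
    rw [e]
    obtain ⟨hB, hqn, hq, hqc, hS, hGq, hW, hFn, hc⟩ :=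
      wrun_inv hf Xhat G hGm hGn hG0 σ.reverse (List.nodup_reverse.mpr hnd)
    obtain ⟨⟨hs1, hs2, hs3⟩, hs4⟩ := sol_spec f Xhat hB
    have hb := why_bound hf Xhat G hG _ _ hW
    have e1 : σ.reverse.toFinset = σ.toFinset := by ext; simp
    have e2 : predErr Xhat σ.reverse = predErr Xhat σ := by simp only [predErr, e1]
    rw [e1, e2] at hb
    set s := wrun f Xhat G σ.reverse
    have h4 : ∑ v ∈ (sol f Xhat s.B).1, f v +
        ∑ v ∈ (sol f Xhat s.B).2 ∩ σ.reverse.toFinset, connCost (sol f Xhat s.B).1 v ≤ s.B := by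
      refine le_trans ?_ hs2
      unfold flCost
      gcongr
      · exact fun i _ _ => connCost_nonneg _ _
      · exact Finset.inter_subset_left
    linarith

lemma lev_bound (n : ℕ) : (2:ℝ) ^ lev n ≤
    20 * (1 + Real.log (2 + (n : ℝ)) / (1 + Real.log (1 + Real.log (2 + (n : ℝ))))) := by
  have hn0 : (0:ℝ) ≤ n := Nat.cast_nonneg n
  have hy0 : 0 < Real.log (2 + (n : ℝ)) := Real.log_pos (by linarith)
  set y := Real.log (2 + (n : ℝ)) with hy
  have hd : 0 < Real.log (1 + y) := Real.log_pos (by linarith)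
  have hq : 0 ≤ y / (1 + Real.log (1 + y)) := by positivity
  rcases Nat.eq_zero_or_pos (lev n) with h0 | hpos
  · rw [h0]; norm_num; linarith
  obtain ⟨k, hk⟩ : ∃ k, lev n = k + 1 := ⟨lev n - 1, by omega⟩
  have hmin : (2 ^ (k + 1)) ^ (2 ^ (k + 1)) < n := by
    have := Nat.find_min (exists_lev n) (m := k) (by change k < lev n; omega)
    exact not_le.mp this
  rw [hk]
  set m : ℕ := 2 ^ (k + 1) with hm
  have hmR : (2:ℝ) ^ (k + 1) = (m : ℝ) := by rw [hm]; push_cast; rfl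
  rw [hmR]
  have hm2 : 2 ≤ m := by rw [hm, pow_succ]; have := Nat.one_le_two_pow (n := k); omega
  have hm2' : (2:ℝ) ≤ m := by exact_mod_cast hm2
  have hmy : (m:ℝ) * Real.log m ≤ y := by
    rw [hy, ← Real.log_pow]
    apply Real.log_le_log (by positivity)
    have : ((m ^ m : ℕ) : ℝ) < n := by exact_mod_cast hmin
    push_cast at this
    linarith
  have hl2 : (0.69:ℝ) < Real.log 2 := by linarith [Real.log_two_gt_d9]
  have hlm : Real.log 2 ≤ Real.log m := Real.log_le_log (by norm_num) hm2'
  suffices h : (m:ℝ) / 20 * (1 + Real.log (1 + y)) ≤ y by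
    rw [← le_div_iff₀ (by linarith)] at h
    linarith
  rcases le_total (1 + y) ((m:ℝ) ^ 4) with hc | hc
  · have h1 : Real.log (1 + y) ≤ 4 * Real.log m := by
      have := Real.log_le_log (by linarith) hc
      rwa [Real.log_pow] at this
    have : (m:ℝ) / 20 * (1 + Real.log (1 + y)) ≤ m * Real.log m := by nlinarith
    linarith
  · -- large y
    have hs : Real.log (1 + y) ≤ 2 * Real.sqrt (1 + y) := by
      have h1 : Real.log (Real.sqrt (1 + y)) ≤ Real.sqrt (1 + y) - 1 :=
        Real.log_le_sub_one_of_pos (Real.sqrt_pos.mpr (by linarith))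
      rw [Real.log_sqrt (by linarith)] at h1
      linarith
    set r := Real.sqrt (1 + y) with hr
    have hr2 : r ^ 2 = 1 + y := Real.sq_sqrt (by linarith)
    have hr0 : 0 ≤ r := Real.sqrt_nonneg _
    have hrm : (m:ℝ) ^ 2 ≤ r := by
      apply Real.le_sqrt_of_sq_le
      calc ((m:ℝ) ^ 2) ^ 2 = (m:ℝ) ^ 4 := by ring
        _ ≤ _ := hc
    have hrm' : 2 * (m:ℝ) ≤ r := by nlinarith
    have : (m:ℝ) / 20 * (1 + Real.log (1 + y)) ≤ r / 40 * (1 + 2 * r) := by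
      apply mul_le_mul <;> linarith
    nlinarith

end FLProof

theorem stmt12 :
    ∃ C : ℝ, 0 < C ∧
      ∀ (V : Type) [Fintype V] [DecidableEq V] [MetricSpace V]
        (f : V → ℝ), (∀ v, 0 ≤ f v) →
        ∀ Xhat : Finset V,
          ∃ ALG : List V → Finset V, FLOnlineAlg ALG ∧
            ∀ σ : List V, σ.Nodup → σ ≠ [] →
              flAlgCost f ALG σ ≤
                C * (1 + Real.log (2 + (predErr Xhat σ : ℝ)) /
                      (1 + Real.log (1 + Real.log (2 + (predErr Xhat σ : ℝ))))) *
                  flOpt f σ.toFinset := by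
  refine ⟨13000, by norm_num, ?_⟩
  intro V _ _ _ f hf Xhat
  obtain ⟨ALG, hA, hb⟩ := FLProof.pred_alg hf Xhat
  refine ⟨ALG, hA, fun σ hnd hne => (hb σ hnd hne).trans ?_⟩
  have h1 := FLProof.lev_bound (predErr Xhat σ)
  have h2 := FLProof.flOpt_nonneg hf σ.toFinset
  refine mul_le_mul_of_nonneg_right ?_ h2
  linarith
end

section
/- There is a constant C > 0 such that for every online Steiner tree instance (a finite metric space (V, dist)) and every prediction X̂ : Finset V, there exists a deterministic online algorithm ALG such that for every duplicate-free terminal sequence σ, c(ALG σ) ≤ C · (1 + log(1 + η(σ))) · opt(σ.toFinset), where log is the natural logarithm. -/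
open Finset

variable {V : Type} [Fintype V] [DecidableEq V] [MetricSpace V]

/-- `E'` connects `A`: all points of `A` lie in a single connected component of the
graph on `V` with edge set `E'`. -/
def stConnects (E' : Finset (Sym2 V)) (A : Finset V) : Prop :=
  ∀ a ∈ A, ∀ b ∈ A, Relation.ReflTransGen (fun u v => s(u, v) ∈ E') a b

/-- Cost of an edge set: sum of the distances between the endpoints of its edges. -/
noncomputable def stCost (E' : Finset (Sym2 V)) : ℝ :=
  ∑ e ∈ E', Sym2.lift ⟨fun u v => dist u v, fun a b => dist_comm a b⟩ e

/-- Offline optimum: cheapest edge set connecting `A`. -/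
noncomputable def stOpt (A : Finset V) : ℝ :=
  sInf {r : ℝ | ∃ E' : Finset (Sym2 V), stConnects E' A ∧ r = stCost E'}

/-- A deterministic online algorithm for Steiner tree: prefix-monotone and always
connecting the arrived terminals. -/
def STOnlineAlg (ALG : List V → Finset (Sym2 V)) : Prop :=
  (∀ (σ : List V) (x : V), ALG σ ⊆ ALG (σ ++ [x])) ∧
  ∀ σ : List V, stConnects (ALG σ) σ.toFinset

set_option linter.unusedSectionVars false

abbrev stR (E : Finset (Sym2 V)) (u v : V) : Prop :=
  Relation.ReflTransGen (fun u v => s(u, v) ∈ E) u v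

lemma stR_symm {E : Finset (Sym2 V)} {u v : V} (h : stR E u v) : stR E v u := by
  induction h with
  | refl => exact Relation.ReflTransGen.refl
  | tail _ h2 ih =>
    refine Relation.ReflTransGen.head ?_ ih
    rw [Sym2.eq_swap]; exact h2

lemma stR_mono {E E' : Finset (Sym2 V)} (hE : E ⊆ E') {u v : V} (h : stR E u v) : stR E' u v :=
  Relation.ReflTransGen.mono (fun _ _ h => hE h) _ _ h

/-- Variation of `f` along an edge. -/
def stVar (f : V → ℝ) (e : Sym2 V) : ℝ :=
  Sym2.lift ⟨fun u v => |f u - f v|, fun a b => abs_sub_comm (f a) (f b)⟩ e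

lemma stVar_nonneg (f : V → ℝ) (e : Sym2 V) : 0 ≤ stVar f e := by
  induction e using Sym2.ind with
  | _ p q => exact abs_nonneg _

lemma stVar_walk (f : V → ℝ) (G : SimpleGraph V) {u v : V} (p : G.Walk u v) :
    |f u - f v| ≤ (p.edges.map (stVar f)).sum := by
  induction p with
  | nil => simp
  | @cons a b c h p ih =>
    have h0 : stVar f s(a, b) = |f a - f b| := rfl
    simp only [SimpleGraph.Walk.edges_cons, List.map_cons, List.sum_cons, h0]
    have := abs_sub_le (f a) (f b) (f c)
    linarith

lemma stVar_path (f : V → ℝ) (E : Finset (Sym2 V)) (u v : V) (h : stR E u v) :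
    |f u - f v| ≤ ∑ e ∈ E, stVar f e := by
  classical
  set G : SimpleGraph V := SimpleGraph.fromEdgeSet (E : Set (Sym2 V)) with hG
  have hr : G.Reachable u v := by
    induction h with
    | refl => exact SimpleGraph.Reachable.refl _
    | @tail b c _ h2 ih =>
      by_cases hbc : b = c
      · subst hbc; exact ih
      · refine ih.trans (SimpleGraph.Adj.reachable ?_)
        rw [hG, SimpleGraph.fromEdgeSet_adj]
        exact ⟨h2, hbc⟩
  obtain ⟨p, hp⟩ := hr.exists_isPath
  refine (stVar_walk f G p).trans ?_
  rw [← List.sum_toFinset _ hp.isTrail.edges_nodup]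
  refine Finset.sum_le_sum_of_subset_of_nonneg ?_ (fun e _ _ => stVar_nonneg f e)
  intro e he
  rw [List.mem_toFinset] at he
  have := p.edges_subset_edgeSet he
  rw [hG, SimpleGraph.edgeSet_fromEdgeSet] at this
  exact this.1

abbrev stD (e : Sym2 V) : ℝ := Sym2.lift ⟨fun u v => dist u v, fun a b => dist_comm a b⟩ e

lemma stD_nonneg (e : Sym2 V) : 0 ≤ stD e := by
  induction e using Sym2.ind with
  | _ p q => exact dist_nonneg

lemma stCost_nonneg (E : Finset (Sym2 V)) : 0 ≤ stCost E :=
  Finset.sum_nonneg (fun e _ => stD_nonneg e)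

lemma stDist_le (E : Finset (Sym2 V)) (u v : V) (h : stR E u v) : dist u v ≤ stCost E := by
  have := stVar_path (fun x => dist u x) E u v h
  simp only [dist_self, zero_sub, abs_neg, abs_of_nonneg (dist_nonneg (x := u) (y := v))] at this
  refine this.trans (Finset.sum_le_sum fun e _ => ?_)
  induction e using Sym2.ind with
  | _ p q =>
    change |dist u p - dist u q| ≤ dist p q
    rw [dist_comm u p, dist_comm u q]; exact abs_dist_sub_le p q u

/-- packing -/
lemma st_pack_edge (T : Finset V) (t : ℝ)
    (hT : ∀ a ∈ T, ∀ b ∈ T, a ≠ b → t ≤ dist a b) (u v : V) :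
    ∑ a ∈ T, |min (dist a u) (t/2) - min (dist a v) (t/2)| ≤ dist u v := by
  classical
  -- at most one center near each point
  have near : ∀ w, ∀ a ∈ T, ∀ b ∈ T, dist a w < t/2 → dist b w < t/2 → a = b := by
    intro w a ha b hb h1 h2
    by_contra hne
    have := hT a ha b hb hne
    have := dist_triangle_right a b w
    linarith
  have far : ∀ a w : V, ¬ dist a w < t/2 → min (dist a w) (t/2) = t/2 :=
    fun a w h => min_eq_right (not_lt.1 h)
  have one : ∀ a, |min (dist a u) (t/2) - min (dist a v) (t/2)| ≤ dist u v := by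
    intro a
    refine (abs_min_sub_min_le_max _ _ _ _).trans ?_
    rw [sub_self, abs_zero, max_eq_left (abs_nonneg _), dist_comm a u, dist_comm a v]
    exact abs_dist_sub_le u v a
  by_cases hu : ∃ a ∈ T, dist a u < t/2
  · obtain ⟨a, ha, hau⟩ := hu
    have hua : ∀ c ∈ T, c ≠ a → min (dist c u) (t/2) = t/2 := fun c hc hca =>
      far _ _ fun h => hca (near u c hc a ha h hau)
    rw [← Finset.add_sum_erase T _ ha]
    by_cases hv : ∃ b ∈ T.erase a, dist b v < t/2
    · obtain ⟨b, hb, hbv⟩ := hv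
      have hbT := Finset.mem_of_mem_erase hb
      have hba := Finset.ne_of_mem_erase hb
      have hvb : ∀ c ∈ T, c ≠ b → min (dist c v) (t/2) = t/2 := fun c hc hca =>
        far _ _ fun h => hca (near v c hc b hbT h hbv)
      rw [← Finset.add_sum_erase (T.erase a) _ hb, Finset.sum_eq_zero]
      · rw [hvb a ha hba.symm, hua b hbT hba, min_eq_left hau.le, min_eq_left hbv.le,
          abs_of_nonpos (by linarith), abs_of_nonneg (by linarith)]
        have := hT a ha b hbT hba.symm
        have := dist_triangle4 a u v b
        rw [dist_comm v b] at this
        linarith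
      · intro c hc
        simp only [Finset.mem_erase] at hc
        rw [hua c hc.2.2 hc.2.1, hvb c hc.2.2 hc.1]; simp
    · push Not at hv
      rw [Finset.sum_eq_zero]
      · simpa using one a
      · intro c hc
        rw [hua c (Finset.mem_of_mem_erase hc) (Finset.ne_of_mem_erase hc),
          far _ _ (not_lt.2 (hv c hc))]; simp
  · push Not at hu
    by_cases hv : ∃ b ∈ T, dist b v < t/2
    · obtain ⟨b, hb, hbv⟩ := hv
      rw [← Finset.add_sum_erase T _ hb, Finset.sum_eq_zero]
      · simpa using one b
      · intro c hc
        rw [far _ _ (not_lt.2 (hu c (Finset.mem_of_mem_erase hc))),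
          far c v fun h => (Finset.ne_of_mem_erase hc)
            (near v c (Finset.mem_of_mem_erase hc) b hb h hbv)]; simp
    · push Not at hv
      rw [Finset.sum_eq_zero]
      · exact dist_nonneg
      · intro c hc
        rw [far _ _ (not_lt.2 (hu c hc)), far _ _ (not_lt.2 (hv c hc))]; simp

lemma st_pack (E : Finset (Sym2 V)) (T : Finset V) (t : ℝ) (ht : 0 ≤ t)
    (hT : ∀ a ∈ T, ∀ b ∈ T, a ≠ b → t ≤ dist a b) (hE : stConnects E T)
    (h2 : 1 < T.card) : T.card * t ≤ 2 * stCost E := by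
  have key : ∀ a ∈ T, t/2 ≤ ∑ e ∈ E, stVar (fun w => min (dist a w) (t/2)) e := by
    intro a ha
    obtain ⟨b, hb, hba⟩ := Finset.exists_mem_ne h2 a
    refine le_trans ?_ (stVar_path _ E a b (hE a ha b hb))
    have := hT a ha b hb hba.symm
    simp only [dist_self]
    rw [min_eq_left (by linarith), min_eq_right (by linarith), zero_sub, abs_neg]
    exact le_abs_self _
  have h1 := Finset.sum_le_sum key
  rw [Finset.sum_comm] at h1
  have h3 : ∑ e ∈ E, ∑ a ∈ T, stVar (fun w => min (dist a w) (t/2)) e ≤ stCost E := by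
    refine Finset.sum_le_sum fun e _ => ?_
    induction e using Sym2.ind with
    | _ p q => exact st_pack_edge T t hT p q
  simp only [Finset.sum_const, nsmul_eq_mul] at h1
  linarith

lemma st_harm {M : ℝ} (hM : 0 ≤ M) (d : V → ℝ) : ∀ (n : ℕ) (S : Finset V), S.card = n →
    (∀ T ⊆ S, T.Nonempty → ∀ t, 0 ≤ t → (∀ x ∈ T, t ≤ d x) → T.card * t ≤ M) →
    (∀ x ∈ S, 0 ≤ d x) →
    ∑ x ∈ S, d x ≤ M * (harmonic n : ℝ) := by
  classical
  intro n
  induction n with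
  | zero =>
    intro S hS _ _
    rw [Finset.card_eq_zero] at hS
    simp [hS]
  | succ n ih =>
    intro S hS h h0
    have hne : S.Nonempty := Finset.card_pos.1 (by omega)
    obtain ⟨x, hx, hmin⟩ := Finset.exists_min_image S d hne
    have h1 := h S (Finset.Subset.refl _) hne (d x) (h0 x hx) hmin
    have h2 := ih (S.erase x) (by rw [Finset.card_erase_of_mem hx]; omega)
      (fun T hT => h T (hT.trans (Finset.erase_subset _ _)))
      (fun y hy => h0 y (Finset.mem_of_mem_erase hy))
    rw [← Finset.add_sum_erase S _ hx, harmonic_succ]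
    push_cast
    rw [hS] at h1
    push_cast at h1
    have h3 : d x ≤ M * ((n : ℝ) + 1)⁻¹ := by
      rw [← div_eq_mul_inv, le_div_iff₀ (by positivity)]; linarith
    linarith

noncomputable def stNear (x : V) (l : List V) : V :=
  if h : l.toFinset.Nonempty then (Finset.exists_min_image l.toFinset (dist x) h).choose else x

lemma stNear_nil (x : V) : stNear x [] = x := by simp [stNear]

lemma stNear_spec (x : V) (l : List V) (h : l ≠ []) :
    stNear x l ∈ l ∧ ∀ y ∈ l, dist x (stNear x l) ≤ dist x y := by
  have h' : l.toFinset.Nonempty := by simpa [List.toFinset_nonempty_iff] using h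
  have := (Finset.exists_min_image l.toFinset (dist x) h').choose_spec
  rw [stNear, dif_pos h']
  simpa using this

def stRt (x : V) : List V → V
  | [] => x
  | y :: l => stRt y l

lemma stRt_mem (x : V) (l : List V) : stRt x l ∈ x :: l := by
  induction l generalizing x with
  | nil => simp [stRt]
  | cons y l ih => exact List.mem_cons_of_mem _ (ih y)

noncomputable def stG (Cov : V → ℝ → Finset V) : List V → ℝ
  | [] => 0
  | x :: l => stG Cov l + if x ∈ Cov (stRt x l) (stG Cov l) then 0 else dist x (stNear x l)

lemma stG_le_cons (Cov : V → ℝ → Finset V) (x : V) (l : List V) :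
    stG Cov l ≤ stG Cov (x :: l) := by
  rw [stG]; split_ifs <;> simp

lemma stG_nonneg (Cov : V → ℝ → Finset V) (l : List V) : 0 ≤ stG Cov l := by
  induction l with
  | nil => simp [stG]
  | cons x l ih => exact ih.trans (stG_le_cons _ _ _)

noncomputable def stCn (Cov : V → ℝ → Finset V) : List V → Finset (Sym2 V)
  | [] => ∅
  | x :: l => stCn Cov l ∪ if x ∈ Cov (stRt x l) (stG Cov l) then ∅ else {s(x, stNear x l)}

noncomputable def stAl (Cov : V → ℝ → Finset V) (Bt : V → ℝ → Finset (Sym2 V)) :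
    List V → Finset (Sym2 V)
  | [] => ∅
  | x :: l => stCn Cov (x :: l) ∪ Bt (stRt x l) (stG Cov (x :: l))

lemma stCost_union (A B : Finset (Sym2 V)) : stCost (A ∪ B) ≤ stCost A + stCost B := by
  unfold stCost
  rw [← Finset.sum_union_inter]
  have := Finset.sum_nonneg (s := A ∩ B) (fun e _ => stD_nonneg e)
  linarith

lemma stCn_cost (Cov : V → ℝ → Finset V) (l : List V) : stCost (stCn Cov l) ≤ stG Cov l := by
  induction l with
  | nil => simp [stCn, stG, stCost]
  | cons x l ih =>
    rw [stCn, stG]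
    refine (stCost_union _ _).trans (add_le_add ih ?_)
    split_ifs
    · simp [stCost]
    · simp [stCost]

lemma stAl_mono (Cov : V → ℝ → Finset V) (Bt : V → ℝ → Finset (Sym2 V))
    (hB : ∀ r g g', g ≤ g' → Bt r g ⊆ Bt r g') (x : V) (l : List V) :
    stAl Cov Bt l ⊆ stAl Cov Bt (x :: l) := by
  cases l with
  | nil => simp [stAl]
  | cons y l =>
    rw [stAl, stAl]
    refine Finset.union_subset_union ?_ (hB _ _ _ (stG_le_cons _ _ _))
    rw [stCn.eq_2 Cov x]
    exact Finset.subset_union_left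

lemma stAl_conn (Cov : V → ℝ → Finset V) (Bt : V → ℝ → Finset (Sym2 V))
    (hB : ∀ r g g', g ≤ g' → Bt r g ⊆ Bt r g')
    (hC : ∀ r g, ∀ z ∈ Cov r g, stR (Bt r g) z r) (x : V) (l : List V) :
    ∀ z ∈ x :: l, stR (stAl Cov Bt (x :: l)) z (stRt x l) := by
  induction l generalizing x with
  | nil =>
    intro z hz
    simp only [List.mem_singleton] at hz
    subst hz
    exact Relation.ReflTransGen.refl
  | cons y l ih =>
    intro z hz
    have hold : ∀ z ∈ y :: l, stR (stAl Cov Bt (x :: y :: l)) z (stRt x (y :: l)) :=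
      fun z hz => stR_mono (stAl_mono Cov Bt hB x _) (ih y z hz)
    rcases List.mem_cons.1 hz with rfl | hz
    · by_cases hc : z ∈ Cov (stRt z (y :: l)) (stG Cov (y :: l))
      · refine stR_mono ?_ (hC _ _ _ hc)
        rw [stAl]
        exact (hB _ _ _ (stG_le_cons _ _ _)).trans Finset.subset_union_right
      · refine Relation.ReflTransGen.head ?_ (hold _ (stNear_spec z (y :: l) (by simp)).1)
        rw [stAl, stCn, if_neg hc]
        simp
    · exact hold z hz

lemma stG_bound (Cov : V → ℝ → Finset V) (O : ℝ) (hO : 0 ≤ O) (Bad : Finset V)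
    (x : V) (l : List V) (hnd : (x :: l).Nodup)
    (hd : ∀ a ∈ x :: l, ∀ b ∈ x :: l, dist a b ≤ O)
    (hBad : ∀ g, O < g → Bad ⊆ Cov (stRt x l) g) :
    ∃ (S : Finset V) (d : V → ℝ), S ⊆ (x :: l).toFinset \ Bad ∧
      (∀ a ∈ S, 0 ≤ d a ∧ d a ≤ O) ∧
      (∀ a ∈ S, ∀ b ∈ S, a ≠ b → min (d a) (d b) ≤ dist a b) ∧
      stG Cov (x :: l) ≤ 2 * O + ∑ a ∈ S, d a := by
  induction l generalizing x with
  | nil =>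
    refine ⟨∅, fun _ => 0, by simp, by simp, by simp, ?_⟩
    simp [stG, stNear_nil, hO]
  | cons y l ih =>
    obtain ⟨S, d, h1, h2, h3, h4⟩ := ih y hnd.of_cons
      (fun a ha b hb => hd a (List.mem_cons_of_mem _ ha) b (List.mem_cons_of_mem _ hb)) hBad
    obtain ⟨hn1, hn2⟩ := stNear_spec x (y :: l) (by simp)
    have hsub : S ⊆ (x :: y :: l).toFinset \ Bad := by
      refine h1.trans (Finset.sdiff_subset_sdiff ?_ (Finset.Subset.refl _))
      intro z hz
      rw [List.mem_toFinset] at hz ⊢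
      exact List.mem_cons_of_mem _ hz
    by_cases hc : x ∈ Cov (stRt x (y :: l)) (stG Cov (y :: l))
    · refine ⟨S, d, hsub, h2, h3, ?_⟩
      rw [stG, if_pos hc]; linarith
    · have hdx : dist x (stNear x (y :: l)) ≤ O :=
        hd _ (by simp) _ (List.mem_cons_of_mem _ hn1)
      by_cases hg : stG Cov (y :: l) ≤ O
      · refine ⟨∅, fun _ => 0, by simp, by simp, by simp, ?_⟩
        rw [stG, if_neg hc, Finset.sum_empty]; linarith
      · push Not at hg
        have hxl : x ∉ y :: l := (List.nodup_cons.1 hnd).1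
        have hSl : ∀ a ∈ S, a ∈ y :: l := fun a ha =>
          List.mem_toFinset.1 (Finset.mem_sdiff.1 (h1 ha)).1
        have hxS : x ∉ S := fun h => hxl (hSl x h)
        have hne : ∀ a ∈ S, a ≠ x := fun a ha h => hxS (h ▸ ha)
        refine ⟨insert x S, Function.update d x (dist x (stNear x (y :: l))), ?_, ?_, ?_, ?_⟩
        · refine Finset.insert_subset ?_ hsub
          rw [Finset.mem_sdiff]
          exact ⟨by simp, fun h => hc (hBad _ hg h)⟩
        · intro a ha
          rcases Finset.mem_insert.1 ha with rfl | ha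
          · simp only [Function.update_self]; exact ⟨dist_nonneg, hdx⟩
          · rw [Function.update_of_ne (hne a ha)]; exact h2 a ha
        · intro a ha b hb hab
          rcases Finset.mem_insert.1 ha with rfl | ha
          · rcases Finset.mem_insert.1 hb with rfl | hb
            · exact absurd rfl hab
            · refine (min_le_left _ _).trans ?_
              rw [Function.update_self]
              exact hn2 b (hSl b hb)
          · rcases Finset.mem_insert.1 hb with hbx | hb
            · subst hbx
              refine (min_le_right _ _).trans ?_
              rw [Function.update_self, dist_comm a b]
              exact hn2 a (hSl a (by assumption))
            · rw [Function.update_of_ne (hne a ha), Function.update_of_ne (hne b hb)]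
              exact h3 a ha b hb hab
        · rw [Finset.sum_insert hxS, Function.update_self,
            Finset.sum_congr rfl (fun a ha => Function.update_of_ne (hne a ha) _ d)]
          rw [stG, if_neg hc]
          linarith

lemma stG_log (Cov : V → ℝ → Finset V) (E : Finset (Sym2 V)) (Bad : Finset V)
    (x : V) (l : List V) (hnd : (x :: l).Nodup)
    (hE : stConnects E (x :: l).toFinset)
    (hBad : ∀ g, stCost E < g → Bad ⊆ Cov (stRt x l) g) (k : ℕ)
    (hk : ((x :: l).toFinset \ Bad).card ≤ k) :
    stG Cov (x :: l) ≤ 4 * (1 + Real.log (1 + k)) * stCost E := by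
  have hO := stCost_nonneg E
  obtain ⟨S, d, h1, h2, h3, h4⟩ := stG_bound Cov (stCost E) hO Bad x l hnd
    (fun a ha b hb => stDist_le E a b
      (hE a (List.mem_toFinset.2 ha) b (List.mem_toFinset.2 hb))) hBad
  have h5 := st_harm (M := 2 * stCost E) (by linarith) d S.card S rfl (by
    intro T hT hTn t ht htd
    rcases Nat.lt_or_ge 1 T.card with hc | hc
    · refine st_pack E T t ht ?_ ?_ hc
      · intro a ha b hb hab
        exact (le_min (htd a ha) (htd b hb)).trans (h3 a (hT ha) b (hT hb) hab)
      · intro a ha b hb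
        exact hE a (Finset.mem_sdiff.1 (h1 (hT ha))).1 b (Finset.mem_sdiff.1 (h1 (hT hb))).1
    · obtain ⟨a, ha⟩ := hTn
      have := htd a ha
      have := (h2 a (hT ha)).2
      have : T.card = 1 := le_antisymm hc (Finset.card_pos.2 ⟨a, ha⟩)
      rw [this]; push_cast; linarith) (fun a ha => (h2 a ha).1)
  have h6 : (harmonic S.card : ℝ) ≤ 1 + Real.log (1 + k) := by
    rcases Nat.eq_zero_or_pos S.card with h0 | h0
    · rw [h0]
      have : 0 ≤ Real.log (1 + (k:ℝ)) := Real.log_nonneg (by simp)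
      simp; linarith
    · refine (harmonic_le_one_add_log _).trans ?_
      have : (S.card : ℝ) ≤ k := by exact_mod_cast (Finset.card_le_card h1).trans hk
      have := Real.log_le_log (x := (S.card : ℝ)) (y := 1 + k) (by exact_mod_cast h0) (by linarith)
      linarith
  have h7 : 0 ≤ Real.log (1 + (k:ℝ)) := Real.log_nonneg (by simp)
  have h8 := mul_le_mul_of_nonneg_left h6 (a := 2 * stCost E) (by linarith)
  nlinarith [mul_nonneg hO h7]

lemma stOpt_attained (A : Finset V) : ∃ E, stConnects E A ∧ stCost E = stOpt A := by
  classical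
  obtain ⟨E, hE, hmin⟩ := Finset.exists_min_image
    ((Finset.univ : Finset (Finset (Sym2 V))).filter (fun E => stConnects E A)) stCost
    (Exists.intro Finset.univ <| by
      simp only [Finset.mem_filter, Finset.mem_univ, true_and]
      exact fun a _ b _ => Relation.ReflTransGen.single (Finset.mem_univ _))
  simp only [Finset.mem_filter, Finset.mem_univ, true_and] at hE hmin
  refine ⟨E, hE, ?_⟩
  unfold stOpt
  symm
  apply IsLeast.csInf_eq
  refine ⟨⟨E, hE, rfl⟩, ?_⟩
  rintro _ ⟨E', hE', rfl⟩
  exact hmin E' hE'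

lemma st_delta (V : Type) [Fintype V] [MetricSpace V] :
    ∃ δ : ℝ, 0 < δ ∧ ∀ a b : V, a ≠ b → δ ≤ dist a b := by
  classical
  by_cases h : ((Finset.univ : Finset (V × V)).filter (fun p => p.1 ≠ p.2)).Nonempty
  · obtain ⟨p, hp, hmin⟩ := Finset.exists_min_image _ (fun p : V × V => dist p.1 p.2) h
    simp only [Finset.mem_filter, Finset.mem_univ, true_and] at hp hmin
    exact ⟨dist p.1 p.2, dist_pos.2 hp, fun a b hab => hmin (a, b) hab⟩
  · refine ⟨1, one_pos, fun a b hab => (h ⟨(a, b), by simpa using hab⟩).elim⟩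

lemma st_tree (Xhat : Finset V) (r : V) (B : ℝ) (hB : 0 ≤ B) :
    ∃ (F : Finset (Sym2 V)) (K : Finset V), stCost F ≤ B ∧ (∀ z ∈ K, stR F z r) ∧ K ⊆ Xhat ∧
      ∀ (E : Finset (Sym2 V)) (A : Finset V), stCost E ≤ B → stConnects E A → r ∈ A →
        (Xhat ∩ A).card ≤ K.card := by
  classical
  obtain ⟨F, hF, hmax⟩ := Finset.exists_max_image
    ((Finset.univ : Finset (Finset (Sym2 V))).filter (fun E => stCost E ≤ B))
    (fun E => (Xhat.filter (fun z => stR E z r)).card)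
    ⟨∅, Finset.mem_filter.2 ⟨Finset.mem_univ _, by simpa [stCost] using hB⟩⟩
  simp only [Finset.mem_filter, Finset.mem_univ, true_and] at hF hmax
  refine ⟨F, Xhat.filter (fun z => stR F z r), hF, fun z hz => (Finset.mem_filter.1 hz).2,
    Finset.filter_subset _ _, ?_⟩
  intro E A hE hA hr
  refine le_trans (Finset.card_le_card ?_) (hmax E hE)
  intro z hz
  rw [Finset.mem_inter] at hz
  exact Finset.mem_filter.2 ⟨hz.1, hA z hz.2 r hr⟩

lemma st_level (δ : ℝ) (hδ : 0 < δ) : ∃ N : ℝ → ℕ, (∀ g g', g ≤ g' → N g ≤ N g') ∧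
    (∀ g, ∀ n, δ * 2 ^ n ≤ 2 * g → n < N g) ∧
    (∀ g, 0 ≤ g → ∑ n ∈ Finset.range (N g), δ * 2 ^ n ≤ 4 * g) := by
  classical
  have hex : ∀ g : ℝ, ∃ n : ℕ, 2 * g < δ * 2 ^ n := by
    intro g
    obtain ⟨n, hn⟩ := pow_unbounded_of_one_lt (2 * g / δ) (one_lt_two (α := ℝ))
    exact ⟨n, by rw [div_lt_iff₀ hδ] at hn; linarith⟩
  refine ⟨fun g => Nat.find (hex g), ?_, ?_, ?_⟩
  · intro g g' h
    exact Nat.find_min' _ (by have := Nat.find_spec (hex g'); linarith)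
  · intro g n hn
    by_contra hlt
    push Not at hlt
    have h1 := Nat.find_spec (hex g)
    have h2 : (2:ℝ) ^ (Nat.find (hex g)) ≤ 2 ^ n := pow_le_pow_right₀ (by norm_num) hlt
    have := mul_le_mul_of_nonneg_left h2 hδ.le
    linarith
  · intro g hg
    rw [← Finset.mul_sum]
    have hs : ∀ m : ℕ, ∑ n ∈ Finset.range m, (2:ℝ) ^ n = 2 ^ m - 1 := by
      intro m
      rw [geom_sum_eq (by norm_num)]; norm_num
    show δ * ∑ n ∈ Finset.range (Nat.find (hex g)), (2:ℝ) ^ n ≤ _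
    rw [hs]
    rcases hN : Nat.find (hex g) with _ | m
    · simpa using hg
    · have := Nat.find_min (hex g) (m := m) (by omega)
      rw [pow_succ]
      nlinarith

theorem stmt13 :
    ∃ C : ℝ, 0 < C ∧
      ∀ (V : Type) [Fintype V] [DecidableEq V] [MetricSpace V]
        (Xhat : Finset V),
        ∃ ALG : List V → Finset (Sym2 V), STOnlineAlg ALG ∧
          ∀ σ : List V, σ.Nodup →
            stCost (ALG σ) ≤
              C * (1 + Real.log (1 + (predErr Xhat σ : ℝ))) * stOpt σ.toFinset := by
  refine ⟨20, by norm_num, ?_⟩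
  intro V _ _ _ Xhat
  obtain ⟨δ, hδ, hδd⟩ := st_delta V
  obtain ⟨N, hN1, hN2, hN3⟩ := st_level δ hδ
  choose F K hF hK hKX hmax using fun (r : V) (n : ℕ) =>
    st_tree Xhat r (δ * 2 ^ n) (by positivity)
  set Bt : V → ℝ → Finset (Sym2 V) := fun r g => (Finset.range (N g)).biUnion (F r) with hBt
  set Cov : V → ℝ → Finset V := fun r g => (Finset.range (N g)).biUnion (K r) with hCov
  have hB : ∀ r g g', g ≤ g' → Bt r g ⊆ Bt r g' := fun r g g' h =>
    Finset.biUnion_subset_biUnion_of_subset_left _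
      (Finset.range_subset_range.2 (hN1 g g' h))
  have hC : ∀ r g, ∀ z ∈ Cov r g, stR (Bt r g) z r := by
    intro r g z hz
    obtain ⟨n, hn, hz⟩ := Finset.mem_biUnion.1 hz
    exact stR_mono (Finset.subset_biUnion_of_mem (F r) hn) (hK r n z hz)
  have hcostB : ∀ r g, 0 ≤ g → stCost (Bt r g) ≤ 4 * g := by
    intro r g hg
    refine le_trans ?_ ((Finset.sum_le_sum fun n _ => hF r n).trans (hN3 g hg))
    have : ∀ s : Finset ℕ, stCost (s.biUnion (F r)) ≤ ∑ n ∈ s, stCost (F r n) := by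
      intro s
      induction s using Finset.induction_on with
      | empty => simp [stCost]
      | insert a s ha ih =>
        rw [Finset.biUnion_insert, Finset.sum_insert ha]
        exact (stCost_union _ _).trans (by linarith)
    exact this _
  refine ⟨fun σ => stAl Cov Bt σ.reverse, ⟨?_, ?_⟩, ?_⟩
  · intro σ x
    simp only [List.reverse_append, List.reverse_singleton, List.singleton_append]
    exact stAl_mono Cov Bt hB x _
  · intro σ a ha b hb
    have ha' : a ∈ σ.reverse := by simpa using ha
    have hb' : b ∈ σ.reverse := by simpa using hb
    show stR (stAl Cov Bt σ.reverse) a b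
    generalize σ.reverse = l at ha' hb'
    cases l with
    | nil => simp at ha'
    | cons x l =>
      exact (stAl_conn Cov Bt hB hC x l a ha').trans (stR_symm (stAl_conn Cov Bt hB hC x l b hb'))
  · intro σ hσ
    have hrev : σ.toFinset = σ.reverse.toFinset := by simp
    unfold predErr
    rw [hrev]
    have hnd : σ.reverse.Nodup := List.nodup_reverse.2 hσ
    show stCost (stAl Cov Bt σ.reverse) ≤ _
    generalize σ.reverse = l at hnd
    obtain ⟨E, hE, hopt⟩ := stOpt_attained l.toFinset
    rw [← hopt]
    cases l with
    | nil =>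
      simp [stAl, stCost]
      exact Finset.sum_nonneg (fun e _ => stD_nonneg e)
    | cons x l =>
      set X := (x :: l).toFinset with hX
      have hO := stCost_nonneg E
      have hcost : stCost (stAl Cov Bt (x :: l)) ≤ 5 * stG Cov (x :: l) := by
        have h1 := stCost_union (stCn Cov (x :: l)) (Bt (stRt x l) (stG Cov (x :: l)))
        have h2 := hcostB (stRt x l) _ (stG_nonneg Cov (x :: l))
        have h3 := stCn_cost Cov (x :: l)
        rw [stAl]
        linarith
      have hrX : stRt x l ∈ X := List.mem_toFinset.2 (stRt_mem x l)
      suffices h : stG Cov (x :: l) ≤ 4 * (1 + Real.log (1 +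
          ((min X.card ((X \ Xhat).card + (Xhat \ X).card) : ℕ) : ℝ))) * stCost E by
        linarith
      by_cases hz : stCost E < δ
      · -- then only one point
        have h0 := stG_log Cov E ∅ x l hnd hE (by simp) _ le_rfl
        have hl : l = [] := by
          cases l with
          | nil => rfl
          | cons y l =>
            exfalso
            have hxy : x ≠ y := by
              rintro rfl
              simp at hnd
            have := hδd x y hxy
            have := stDist_le E x y (hE x (List.mem_toFinset.2 (by simp)) y (List.mem_toFinset.2 (by simp)))
            linarith
        subst hl
        have : stG Cov [x] = 0 := by simp [stG, stNear_nil]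
        rw [this]
        have : 0 ≤ Real.log (1 + ((min X.card ((X \ Xhat).card + (Xhat \ X).card) : ℕ) : ℝ)) :=
          Real.log_nonneg (le_add_of_nonneg_right (Nat.cast_nonneg _))
        positivity
      · push Not at hz
        -- level
        have hlev : ∃ n : ℕ, stCost E ≤ δ * 2 ^ n ∧ δ * 2 ^ n ≤ 2 * stCost E := by
          have hex : ∃ n : ℕ, stCost E ≤ δ * 2 ^ n := by
            obtain ⟨n, hn⟩ := pow_unbounded_of_one_lt (stCost E / δ) (one_lt_two (α := ℝ))
            exact ⟨n, by rw [div_lt_iff₀ hδ] at hn; linarith⟩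
          classical
          refine ⟨Nat.find hex, Nat.find_spec hex, ?_⟩
          rcases hm : Nat.find hex with _ | m
          · simp; linarith
          · have := Nat.find_min hex (m := m) (by omega)
            rw [pow_succ]
            linarith
        obtain ⟨n, hn1, hn2⟩ := hlev
        refine stG_log Cov E (K (stRt x l) n) x l hnd hE ?_ _ ?_
        · intro g hg
          exact Finset.subset_biUnion_of_mem (K (stRt x l))
            (Finset.mem_range.2 (hN2 g n (by linarith)))
        · refine le_min (Finset.card_le_card Finset.sdiff_subset) ?_
          have h1 := hmax (stRt x l) n E X hn1 hE hrX
          have h2 : X \ K (stRt x l) n ⊆ (X \ Xhat) ∪ (Xhat \ K (stRt x l) n) := by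
            intro z hz
            simp only [Finset.mem_union, Finset.mem_sdiff] at hz ⊢
            tauto
          have h3 := (Finset.card_le_card h2).trans (Finset.card_union_le _ _)
          have h4 := Finset.card_sdiff_add_card_eq_card (hKX (stRt x l) n)
          have h5 := Finset.card_sdiff_add_card_inter Xhat X
          change (X \ K (stRt x l) n).card ≤ _
          omega
end
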